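/- arXiv:2012.09621 — 6 statements merged into one kernel-verified Lean document; each statement's English description precedes it below -/
import Mathlib

section
/- Let L > 0 and let f : [0,∞) → [0,∞) be monotonically decreasing with ∫₀^∞ f(t²) t dt < ∞ and ∫₀^∞ f(t²) dt < ∞. Then | (1/L²) Σ_{k ∈ Λ_L} f(|k|²) − (1/(2π)) ∫₀^∞ f(t²) t dt | ≤ (2/(πL)) ∫₀^∞ f(t²) dt + 3 f(0)/L². -/
open Real MeasureTheory Set

/-- The momentum lattice point `(2π/L)·z` for `z ∈ ℤ²`. -/
noncomputable def kvec (L : ℝ) (z : ℤ × ℤ) : ℝ × ℝ :=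
  ((2 * Real.pi / L) * z.1, (2 * Real.pi / L) * z.2)

/-- Euclidean norm squared on `ℝ²`. -/
noncomputable def nsq (v : ℝ × ℝ) : ℝ := v.1 ^ 2 + v.2 ^ 2

theorem setLIntegral_Ioi_zero_eq_tsum_Ioc (g : ℝ → ENNReal) :
    ∫⁻ x in Ioi (0 : ℝ), g x = ∑' n : ℕ, ∫⁻ x in Ioc (n : ℝ) (n + 1), g x := by
  have hU : Ioi (0 : ℝ) = ⋃ n : ℕ, Ioc (n : ℝ) (n + 1) := by
    ext x
    simp only [mem_Ioi, mem_iUnion, mem_Ioc]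
    constructor
    · intro hx
      have hpos : 0 < ⌈x⌉₊ := Nat.ceil_pos.2 hx
      refine ⟨⌈x⌉₊ - 1, Nat.lt_ceil.1 (by omega), ?_⟩
      rw [← Nat.cast_succ, Nat.succ_eq_add_one, Nat.sub_add_cancel hpos]
      exact Nat.le_ceil x
    · rintro ⟨n, hn, -⟩
      exact lt_of_le_of_lt n.cast_nonneg hn
  rw [hU, lintegral_iUnion (fun n => measurableSet_Ioc)]
  intro m n hmn
  refine Set.disjoint_left.2 fun x hx hy => hmn ?_
  have h1 : (m : ℝ) < n + 1 := hx.1.trans_le hy.2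
  have h2 : (n : ℝ) < m + 1 := hy.1.trans_le hx.2
  norm_cast at h1 h2
  omega

theorem AntitoneOn.setLIntegral_Ioi_zero_le_tsum {g : ℝ → ENNReal} (hg : AntitoneOn g (Ici 0)) :
    ∫⁻ x in Ioi (0 : ℝ), g x ≤ ∑' n : ℕ, g n := by
  rw [setLIntegral_Ioi_zero_eq_tsum_Ioc]
  refine ENNReal.tsum_le_tsum fun n => ?_
  calc ∫⁻ x in Ioc (n : ℝ) (n + 1), g x ≤ ∫⁻ _ in Ioc (n : ℝ) (n + 1), g n :=
        setLIntegral_mono' measurableSet_Ioc fun x hx =>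
          hg (mem_Ici.2 n.cast_nonneg) (mem_Ici.2 (n.cast_nonneg.trans hx.1.le)) hx.1.le
    _ = g n := by simp

theorem AntitoneOn.tsum_succ_le_setLIntegral_Ioi_zero {g : ℝ → ENNReal}
    (hg : AntitoneOn g (Ici 0)) :
    ∑' n : ℕ, g (n + 1) ≤ ∫⁻ x in Ioi (0 : ℝ), g x := by
  rw [setLIntegral_Ioi_zero_eq_tsum_Ioc]
  refine ENNReal.tsum_le_tsum fun n => ?_
  calc g (n + 1) = ∫⁻ _ in Ioc (n : ℝ) (n + 1), g (n + 1) := by simp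
    _ ≤ ∫⁻ x in Ioc (n : ℝ) (n + 1), g x :=
        setLIntegral_mono' measurableSet_Ioc fun x hx =>
          hg (mem_Ici.2 (n.cast_nonneg.trans hx.1.le)) (mem_Ici.2 (by positivity)) hx.2

theorem tsum_int_eq_add_two_mul_tsum_succ_of_even {g : ℝ → ENNReal} (hg : ∀ x, g (-x) = g x) :
    ∑' n : ℤ, g n = g 0 + 2 * ∑' n : ℕ, g (n + 1) := by
  rw [tsum_of_nat_of_neg_add_one (f := fun n : ℤ => g n) ENNReal.summable ENNReal.summable,
    tsum_eq_zero_add' (f := fun n : ℕ => g ((n : ℤ) : ℝ)) ENNReal.summable, two_mul, ← add_assoc]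
  · congr 1
    · simp
    · refine tsum_congr fun n => ?_
      rw [← hg]
      simp

theorem lintegral_eq_two_mul_setLIntegral_Ioi_of_even {g : ℝ → ENNReal}
    (hg : ∀ x, g (-x) = g x) :
    ∫⁻ x, g x = 2 * ∫⁻ x in Ioi (0 : ℝ), g x := by
  have h1 : ∫⁻ x in Iio (0 : ℝ), g x = ∫⁻ x in Ioi (0 : ℝ), g x := by
    have := (Measure.measurePreserving_neg (volume : Measure ℝ)).setLIntegral_comp_preimage_emb
      (MeasurableEquiv.neg ℝ).measurableEmbedding g (Ioi 0)
    rw [← this]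
    simp [hg]
  rw [← lintegral_add_compl g (measurableSet_Ioi (a := (0 : ℝ))), compl_Ioi,
    setLIntegral_congr (Iio_ae_eq_Iic (a := (0 : ℝ)) (μ := volume)).symm, h1, two_mul]

theorem lintegral_lintegral_sq_add_sq {Φ : ℝ → ENNReal} (hΦ : Measurable Φ) :
    ∫⁻ x : ℝ, ∫⁻ y : ℝ, Φ (x ^ 2 + y ^ 2) =
      ENNReal.ofReal (2 * π) * ∫⁻ r in Ioi (0 : ℝ), ENNReal.ofReal r * Φ (r ^ 2) := by
  have hm : Measurable fun p : ℝ × ℝ => Φ (p.1 ^ 2 + p.2 ^ 2) := hΦ.comp (by fun_prop)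
  have hm' : Measurable fun r : ℝ => ENNReal.ofReal r * Φ (r ^ 2) := by
    have : Measurable fun r : ℝ => Φ (r ^ 2) := hΦ.comp (by fun_prop)
    fun_prop
  have h := lintegral_comp_polarCoord_symm fun p : ℝ × ℝ => Φ (p.1 ^ 2 + p.2 ^ 2)
  rw [Measure.volume_eq_prod, lintegral_prod _ hm.aemeasurable] at h
  rw [← h]
  have e : ∀ p : ℝ × ℝ, ENNReal.ofReal p.1 • Φ ((polarCoord.symm p).1 ^ 2 +
      (polarCoord.symm p).2 ^ 2) = ENNReal.ofReal p.1 * Φ (p.1 ^ 2) := by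
    intro p
    rw [polarCoord_symm_apply, smul_eq_mul]
    congr 2
    linear_combination p.1 ^ 2 * Real.sin_sq_add_cos_sq p.2
  simp_rw [e]
  change ∫⁻ p in Ioi (0 : ℝ) ×ˢ Ioo (-π) π, _ ∂_ = _
  rw [← Measure.prod_restrict,
    lintegral_prod _ (by exact (hm'.comp measurable_fst).aemeasurable)]
  simp only [lintegral_const, Measure.restrict_apply MeasurableSet.univ, univ_inter,
    Real.volume_Ioo]
  rw [lintegral_mul_const _ hm', mul_comm]
  congr 2
  ring

/-- Two-sided comparison of the lattice sum of an antitone function of `x² + y²` over `ℤ²` with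
its integral over the plane, the error being the contribution of the axes. -/
theorem tsum_int_prod_sq_add_sq_bounds {Φ : ℝ → ENNReal} (hΦ : Antitone Φ) :
    ∑' z : ℤ × ℤ, Φ ((z.1 : ℝ) ^ 2 + (z.2 : ℝ) ^ 2) ≤
        ENNReal.ofReal (2 * π) * (∫⁻ r in Ioi (0 : ℝ), ENNReal.ofReal r * Φ (r ^ 2)) +
          4 * (∫⁻ r in Ioi (0 : ℝ), Φ (r ^ 2)) + Φ 0 ∧
      ENNReal.ofReal (2 * π) * (∫⁻ r in Ioi (0 : ℝ), ENNReal.ofReal r * Φ (r ^ 2)) ≤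
        ∑' z : ℤ × ℤ, Φ ((z.1 : ℝ) ^ 2 + (z.2 : ℝ) ^ 2) +
          4 * (∫⁻ r in Ioi (0 : ℝ), Φ (r ^ 2)) + 3 * Φ 0 := by
  have hsq : AntitoneOn (fun r : ℝ => Φ (r ^ 2)) (Ici 0) := fun x hx y _ hxy =>
    hΦ (pow_le_pow_left₀ hx hxy 2)
  have hy : ∀ x : ℝ, AntitoneOn (fun y : ℝ => Φ (x ^ 2 + y ^ 2)) (Ici 0) := fun x y _ z _ hyz =>
    hΦ (by gcongr)
  have hx : AntitoneOn (fun x : ℝ => ∫⁻ y in Ioi (0 : ℝ), Φ (x ^ 2 + y ^ 2)) (Ici 0) :=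
    fun x _ z _ hxz => lintegral_mono fun y => hΦ (by gcongr)
  set S := ∑' n : ℕ, Φ (((n : ℝ) + 1) ^ 2) with hS
  set P := ∑' m : ℕ, ∑' n : ℕ, Φ (((m : ℝ) + 1) ^ 2 + ((n : ℝ) + 1) ^ 2) with hP
  set I := ∫⁻ x in Ioi (0 : ℝ), ∫⁻ y in Ioi (0 : ℝ), Φ (x ^ 2 + y ^ 2) with hI
  have hSJ : S ≤ ∫⁻ r in Ioi (0 : ℝ), Φ (r ^ 2) := hsq.tsum_succ_le_setLIntegral_Ioi_zero
  have hPI : P ≤ I :=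
    (ENNReal.tsum_le_tsum fun m : ℕ =>
      (hy ((m : ℝ) + 1)).tsum_succ_le_setLIntegral_Ioi_zero).trans
        hx.tsum_succ_le_setLIntegral_Ioi_zero
  have hIQ : I ≤ ∑' m : ℕ, ∑' n : ℕ, Φ ((m : ℝ) ^ 2 + (n : ℝ) ^ 2) :=
    hx.setLIntegral_Ioi_zero_le_tsum.trans
      (ENNReal.tsum_le_tsum fun m : ℕ => (hy (m : ℝ)).setLIntegral_Ioi_zero_le_tsum)
  have hQ : ∑' m : ℕ, ∑' n : ℕ, Φ ((m : ℝ) ^ 2 + (n : ℝ) ^ 2) = Φ 0 + 2 * S + P := by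
    have h0 : ∀ g : ℕ → ENNReal, ∑' n, g n = g 0 + ∑' n, g (n + 1) := fun g =>
      tsum_eq_zero_add' ENNReal.summable
    rw [h0, h0]
    simp_rw [h0 (fun n : ℕ => Φ (((_ + 1 : ℕ) : ℝ) ^ 2 + (n : ℝ) ^ 2))]
    rw [ENNReal.tsum_add]
    simp only [Nat.cast_zero, Nat.cast_add, Nat.cast_one, zero_pow two_ne_zero, zero_add, add_zero,
      ← hS, ← hP]
    ring
  have hA : ∑' z : ℤ × ℤ, Φ ((z.1 : ℝ) ^ 2 + (z.2 : ℝ) ^ 2) = Φ 0 + 4 * S + 4 * P := by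
    rw [ENNReal.tsum_prod (f := fun a b : ℤ => Φ ((a : ℝ) ^ 2 + (b : ℝ) ^ 2)),
      tsum_int_eq_add_two_mul_tsum_succ_of_even
        (g := fun x : ℝ => ∑' b : ℤ, Φ (x ^ 2 + (b : ℝ) ^ 2)) (by simp)]
    simp_rw [fun x : ℝ => tsum_int_eq_add_two_mul_tsum_succ_of_even
        (g := fun y : ℝ => Φ (x ^ 2 + y ^ 2)) (by simp)]
    rw [ENNReal.tsum_add, ENNReal.tsum_mul_left]
    simp only [zero_pow two_ne_zero, zero_add, add_zero, ← hS, ← hP]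
    ring
  have hpolar : ENNReal.ofReal (2 * π) *
      (∫⁻ r in Ioi (0 : ℝ), ENNReal.ofReal r * Φ (r ^ 2)) = 4 * I := by
    rw [← lintegral_lintegral_sq_add_sq hΦ.measurable,
      lintegral_eq_two_mul_setLIntegral_Ioi_of_even (by simp)]
    simp_rw [fun x : ℝ => lintegral_eq_two_mul_setLIntegral_Ioi_of_even
        (g := fun y : ℝ => Φ (x ^ 2 + y ^ 2)) (by simp)]
    rw [lintegral_const_mul' _ _ ENNReal.ofNat_ne_top, ← mul_assoc]
    norm_num
    rfl
  rw [hpolar, hA]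
  constructor
  · calc Φ 0 + 4 * S + 4 * P = 4 * P + 4 * S + Φ 0 := by ring
      _ ≤ _ := by gcongr
  · calc 4 * I ≤ 4 * (Φ 0 + 2 * S + P) := by gcongr; exact hIQ.trans_eq hQ
      _ = (Φ 0 + 4 * S + 4 * P) + 4 * S + 3 * Φ 0 := by ring
      _ ≤ _ := by gcongr

theorem stmt_0 (L : ℝ) (hL : 0 < L) (f : ℝ → ℝ)
    (hf0 : ∀ t, 0 ≤ t → 0 ≤ f t)
    (hmono : ∀ s t, 0 ≤ s → s ≤ t → f t ≤ f s)
    (hint1 : IntegrableOn (fun t => f (t ^ 2) * t) (Ioi (0 : ℝ)))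
    (hint2 : IntegrableOn (fun t => f (t ^ 2)) (Ioi (0 : ℝ))) :
    Summable (fun z : ℤ × ℤ => f (nsq (kvec L z))) ∧
    |(1 / L ^ 2) * (∑' z : ℤ × ℤ, f (nsq (kvec L z)))
        - (1 / (2 * π)) * ∫ t in Ioi (0 : ℝ), f (t ^ 2) * t| ≤
      (2 / (π * L)) * (∫ t in Ioi (0 : ℝ), f (t ^ 2)) + 3 * f 0 / L ^ 2 := by
  set h : ℝ := 2 * π / L with hh
  have hpos : 0 < h := by positivity
  set Φ : ℝ → ENNReal := fun s => ENNReal.ofReal (f (h ^ 2 * max s 0)) with hΦdef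
  have hΦ : Antitone Φ := fun s t hst =>
    ENNReal.ofReal_le_ofReal (hmono _ _ (by positivity) (by gcongr))
  have hΦ' : ∀ s, 0 ≤ s → Φ s = ENNReal.ofReal (f (h ^ 2 * s)) := fun s hs => by
    simp only [hΦdef, max_eq_left hs]
  have hterm : ∀ z : ℤ × ℤ, ENNReal.ofReal (f (nsq (kvec L z))) =
      Φ ((z.1 : ℝ) ^ 2 + (z.2 : ℝ) ^ 2) := fun z => by
    rw [hΦ' _ (by positivity)]
    simp only [nsq, kvec, ← hh]
    congr 2
    ring
  have hterm0 : ∀ z : ℤ × ℤ, 0 ≤ f (nsq (kvec L z)) := fun z =>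
    hf0 _ (by unfold nsq; positivity)
  set I1 := ∫ t in Ioi (0 : ℝ), f (t ^ 2) * t with hI1
  set I2 := ∫ t in Ioi (0 : ℝ), f (t ^ 2) with hI2
  have hI1n : 0 ≤ I1 := setIntegral_nonneg measurableSet_Ioi fun t ht =>
    mul_nonneg (hf0 _ (sq_nonneg t)) (le_of_lt ht)
  have hI2n : 0 ≤ I2 := setIntegral_nonneg measurableSet_Ioi fun t _ => hf0 _ (sq_nonneg t)
  have hJ2 : ∫⁻ r in Ioi (0 : ℝ), Φ (r ^ 2) = ENNReal.ofReal (h⁻¹ * I2) := by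
    have hs := integral_comp_mul_left_Ioi (fun t => f (t ^ 2)) 0 hpos
    have hi := (integrableOn_Ioi_comp_mul_left_iff (fun t => f (t ^ 2)) 0 hpos).2
      (by simpa using hint2)
    rw [mul_zero, smul_eq_mul, ← hI2] at hs
    rw [← hs, ofReal_integral_eq_lintegral_ofReal hi (ae_of_all _ fun t => hf0 _ (sq_nonneg _))]
    refine lintegral_congr fun r => ?_
    rw [hΦ' _ (sq_nonneg r), mul_pow]
  have hJ1 : ∫⁻ r in Ioi (0 : ℝ), ENNReal.ofReal r * Φ (r ^ 2) =
      ENNReal.ofReal (h⁻¹ * (h⁻¹ * I1)) := by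
    have hs := integral_comp_mul_left_Ioi (fun t => f (t ^ 2) * t) 0 hpos
    have hi := (integrableOn_Ioi_comp_mul_left_iff (fun t => f (t ^ 2) * t) 0 hpos).2
      (by simpa using hint1)
    rw [mul_zero, smul_eq_mul, ← hI1] at hs
    rw [← hs, ← integral_const_mul, ofReal_integral_eq_lintegral_ofReal (hi.const_mul _)]
    · refine setLIntegral_congr_fun measurableSet_Ioi fun r hr => ?_
      have hr0 : 0 ≤ r := le_of_lt hr
      rw [hΦ' _ (sq_nonneg r), ← ENNReal.ofReal_mul hr0, mul_pow]
      congr 1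
      field_simp
    · refine (ae_restrict_iff' measurableSet_Ioi).2 (ae_of_all _ fun t ht => ?_)
      have ht0 : 0 ≤ t := le_of_lt ht
      have := hf0 _ (sq_nonneg (h * t))
      simp only [Pi.zero_apply]
      positivity
  have hΦ0 : Φ 0 = ENNReal.ofReal (f 0) := by rw [hΦ' 0 le_rfl, mul_zero]
  have hf00 : 0 ≤ f 0 := hf0 0 le_rfl
  obtain ⟨hup, hlow⟩ := tsum_int_prod_sq_add_sq_bounds hΦ
  simp_rw [← hterm] at hup hlow
  rw [hJ1, hJ2, hΦ0] at hup hlow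
  have h4 : (4 : ENNReal) = ENNReal.ofReal 4 := by simp
  have h3 : (3 : ENNReal) = ENNReal.ofReal 3 := by simp
  rw [h4, ← ENNReal.ofReal_mul (by positivity), ← ENNReal.ofReal_mul (by positivity),
    ← ENNReal.ofReal_add (by positivity) (by positivity),
    ← ENNReal.ofReal_add (by positivity) (by positivity)] at hup
  have hsum : Summable fun z : ℤ × ℤ => f (nsq (kvec L z)) := by
    have := ENNReal.summable_toReal (ne_top_of_le_ne_top ENNReal.ofReal_ne_top hup)
    simpa only [ENNReal.toReal_ofReal (hterm0 _)] using this
  refine ⟨hsum, ?_⟩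
  set A := ∑' z : ℤ × ℤ, f (nsq (kvec L z)) with hAdef
  have hA0 : 0 ≤ A := tsum_nonneg hterm0
  rw [← ENNReal.ofReal_tsum_of_nonneg hterm0 hsum] at hup hlow
  rw [h4, h3, ← ENNReal.ofReal_mul (by positivity), ← ENNReal.ofReal_mul (by positivity),
    ← ENNReal.ofReal_mul (by positivity),
    ← ENNReal.ofReal_add (by positivity) (by positivity),
    ← ENNReal.ofReal_add (by positivity) (by positivity),
    ENNReal.ofReal_le_ofReal_iff (by positivity)] at hlow
  rw [ENNReal.ofReal_le_ofReal_iff (by positivity)] at hup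
  have e1 : 1 / (2 * π) * I1 = 1 / L ^ 2 * (2 * π * (h⁻¹ * (h⁻¹ * I1))) := by
    rw [hh]; field_simp
  have e2 : 2 / (π * L) * I2 + 3 * f 0 / L ^ 2 =
      1 / L ^ 2 * (4 * (h⁻¹ * I2) + 3 * f 0) := by
    rw [hh]; field_simp; ring
  rw [e1, e2, ← mul_sub, abs_mul, abs_of_pos (by positivity : 0 < 1 / L ^ 2)]
  gcongr
  rw [abs_le]
  constructor <;> linarith
end

section
/- Let L > 0, s₀ ≥ 0 and let f : [s₀,∞) → [0,∞) be monotonically decreasing with ∫_{√s₀}^∞ f(t²) t dt < ∞ and ∫_{√s₀}^∞ f(t²) dt < ∞. Then | (1/L²) Σ_{k ∈ Λ_L, |k|² ≥ s₀} f(|k|²) − (1/(2π)) ∫_{√s₀}^∞ f(t²) t dt | ≤ (2/(πL)) ∫_{√s₀}^∞ f(t²) dt + (4√s₀/(πL) + 6/L²) f(s₀). -/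
open Real MeasureTheory Set

section LatticeSums

open scoped ENNReal

lemma lintegral_Ioi_zero_eq_tsum_Ioc {h : ℝ} (hh : 0 < h) (φ : ℝ → ℝ≥0∞) :
    ∫⁻ x in Ioi (0 : ℝ), φ x = ∑' n : ℕ, ∫⁻ x in Ioc (h * n) (h * (n + 1 : ℕ)), φ x := by
  have hU : Ioi (0 : ℝ) = ⋃ n : ℕ, Ioc (h * n) (h * (n + 1 : ℕ)) := by
    ext x
    simp only [mem_Ioi, mem_iUnion, mem_Ioc]
    constructor
    · intro hx
      have hxh : 0 < x / h := div_pos hx hh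
      obtain ⟨n, hn⟩ : ∃ n : ℕ, ⌈x / h⌉₊ = n + 1 :=
        ⟨⌈x / h⌉₊ - 1, by have := Nat.ceil_pos.2 hxh; omega⟩
      obtain ⟨h1, h2⟩ := (Nat.ceil_eq_iff (Nat.succ_ne_zero n)).1 hn
      refine ⟨n, ?_, ?_⟩
      · rw [lt_div_iff₀ hh] at h1
        simpa [mul_comm] using h1
      · rw [div_le_iff₀ hh] at h2
        simpa [mul_comm] using h2
    · rintro ⟨n, hn, -⟩
      exact lt_of_le_of_lt (by positivity) hn
  have hm : Monotone fun n : ℕ => h * (n : ℝ) := fun a b hab => by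
    have : (a : ℝ) ≤ b := by exact_mod_cast hab
    exact mul_le_mul_of_nonneg_left this hh.le
  rw [hU, lintegral_iUnion (fun _ => measurableSet_Ioc)]
  exact hm.pairwise_disjoint_on_Ioc_succ

lemma tsum_succ_le_lintegral {h : ℝ} (hh : 0 < h) {φ : ℝ → ℝ≥0∞}
    (hφ : AntitoneOn φ (Ici 0)) :
    ENNReal.ofReal h * ∑' n : ℕ, φ (h * (n + 1 : ℕ)) ≤ ∫⁻ x in Ioi (0 : ℝ), φ x := by
  rw [lintegral_Ioi_zero_eq_tsum_Ioc hh, ← ENNReal.tsum_mul_left]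
  refine ENNReal.tsum_le_tsum fun n => ?_
  calc ENNReal.ofReal h * φ (h * (n + 1 : ℕ))
      = ∫⁻ _ in Ioc (h * n) (h * (n + 1 : ℕ)), φ (h * (n + 1 : ℕ)) := by
        rw [setLIntegral_const, Real.volume_Ioc, mul_comm]
        congr 2
        push_cast
        ring
    _ ≤ _ := setLIntegral_mono' measurableSet_Ioc fun x hx =>
        hφ (mem_Ici.2 (le_trans (by positivity) hx.1.le)) (mem_Ici.2 (by positivity)) hx.2

lemma lintegral_le_tsum {h : ℝ} (hh : 0 < h) {φ : ℝ → ℝ≥0∞}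
    (hφ : AntitoneOn φ (Ici 0)) :
    ∫⁻ x in Ioi (0 : ℝ), φ x ≤ ENNReal.ofReal h * ∑' n : ℕ, φ (h * n) := by
  rw [lintegral_Ioi_zero_eq_tsum_Ioc hh, ← ENNReal.tsum_mul_left]
  refine ENNReal.tsum_le_tsum fun n => ?_
  calc _ ≤ ∫⁻ _ in Ioc (h * n) (h * (n + 1 : ℕ)), φ (h * n) :=
        setLIntegral_mono' measurableSet_Ioc fun x hx =>
          hφ (mem_Ici.2 (by positivity)) (mem_Ici.2 (le_trans (by positivity) hx.1.le)) hx.1.le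
    _ = ENNReal.ofReal h * φ (h * n) := by
        rw [setLIntegral_const, Real.volume_Ioc, mul_comm]
        congr 2
        push_cast
        ring

lemma antitoneOn_radial {H : ℝ → ℝ≥0∞} (hH : Antitone H) (a : ℝ) :
    AntitoneOn (fun y => H (a ^ 2 + y ^ 2)) (Ici 0) := fun y hy z _ hyz =>
  hH (by gcongr)

lemma antitoneOn_lintegral_radial {H : ℝ → ℝ≥0∞} (hH : Antitone H) :
    AntitoneOn (fun x => ∫⁻ y in Ioi (0 : ℝ), H (x ^ 2 + y ^ 2)) (Ici 0) := fun x hx z _ hxz =>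
  lintegral_mono fun y => hH (by gcongr)

lemma tsum_tsum_succ_le_lintegral {h : ℝ} (hh : 0 < h) {H : ℝ → ℝ≥0∞} (hH : Antitone H) :
    ENNReal.ofReal h ^ 2 *
        ∑' m : ℕ, ∑' n : ℕ, H ((h * (m + 1 : ℕ)) ^ 2 + (h * (n + 1 : ℕ)) ^ 2) ≤
      ∫⁻ x in Ioi (0 : ℝ), ∫⁻ y in Ioi (0 : ℝ), H (x ^ 2 + y ^ 2) := by
  refine le_trans ?_ (tsum_succ_le_lintegral hh (antitoneOn_lintegral_radial hH))
  rw [pow_two, mul_assoc, ← ENNReal.tsum_mul_left]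
  gcongr
  exact tsum_succ_le_lintegral hh (antitoneOn_radial hH _)

lemma lintegral_le_tsum_tsum {h : ℝ} (hh : 0 < h) {H : ℝ → ℝ≥0∞} (hH : Antitone H) :
    ∫⁻ x in Ioi (0 : ℝ), ∫⁻ y in Ioi (0 : ℝ), H (x ^ 2 + y ^ 2) ≤
      ENNReal.ofReal h ^ 2 * ∑' m : ℕ, ∑' n : ℕ, H ((h * m) ^ 2 + (h * n) ^ 2) := by
  refine (lintegral_le_tsum hh (antitoneOn_lintegral_radial hH)).trans ?_
  rw [pow_two, mul_assoc, ← ENNReal.tsum_mul_left (a := ENNReal.ofReal h)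
    (f := fun m : ℕ => ∑' n : ℕ, H ((h * m) ^ 2 + (h * n) ^ 2))]
  gcongr
  exact lintegral_le_tsum hh (antitoneOn_radial hH _)

lemma cos_pos_and_sin_pos_iff {θ : ℝ} (hθ : θ ∈ Ioo (-π) π) :
    (0 < cos θ ∧ 0 < sin θ) ↔ θ ∈ Ioo 0 (π / 2) := by
  constructor
  · rintro ⟨hc, hs⟩
    have h0 : 0 < θ := by
      by_contra! h
      exact absurd hs (not_lt.2 (sin_nonpos_of_nonpos_of_neg_pi_le h hθ.1.le))
    refine ⟨h0, ?_⟩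
    by_contra! h
    exact absurd hc (not_lt.2 (cos_nonpos_of_pi_div_two_le_of_le h (by linarith [hθ.2, pi_pos])))
  · rintro ⟨h0, h1⟩
    exact ⟨cos_pos_of_mem_Ioo ⟨by linarith [pi_pos], h1⟩,
      sin_pos_of_pos_of_lt_pi h0 (by linarith [pi_pos])⟩

lemma lintegral_quadrant_radial {H : ℝ → ℝ≥0∞} (hH : Antitone H) :
    ∫⁻ x in Ioi (0 : ℝ), ∫⁻ y in Ioi (0 : ℝ), H (x ^ 2 + y ^ 2) =
      ENNReal.ofReal (π / 2) * ∫⁻ r in Ioi (0 : ℝ), ENNReal.ofReal r * H (r ^ 2) := by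
  have hHm : Measurable H := hH.measurable
  have hQ : MeasurableSet (Ioi (0 : ℝ) ×ˢ Ioi (0 : ℝ)) := measurableSet_Ioi.prod measurableSet_Ioi
  calc ∫⁻ x in Ioi (0 : ℝ), ∫⁻ y in Ioi (0 : ℝ), H (x ^ 2 + y ^ 2)
      = ∫⁻ p in Ioi (0 : ℝ) ×ˢ Ioi (0 : ℝ), H (p.1 ^ 2 + p.2 ^ 2) := by
        rw [Measure.volume_eq_prod, ← Measure.prod_restrict, lintegral_prod]
        fun_prop
    _ = ∫⁻ p : ℝ × ℝ, (Ioi (0 : ℝ) ×ˢ Ioi (0 : ℝ)).indicator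
          (fun p => H (p.1 ^ 2 + p.2 ^ 2)) p := (lintegral_indicator hQ _).symm
    _ = ∫⁻ p in polarCoord.target, ENNReal.ofReal p.1 •
          (Ioi (0 : ℝ) ×ˢ Ioi (0 : ℝ)).indicator
            (fun p => H (p.1 ^ 2 + p.2 ^ 2)) (polarCoord.symm p) :=
        (lintegral_comp_polarCoord_symm _).symm
    _ = ∫⁻ p in Ioi (0 : ℝ) ×ˢ Ioo (-π) π, (ENNReal.ofReal p.1 * H (p.1 ^ 2)) *
          (Ioo 0 (π / 2)).indicator 1 p.2 := by
        rw [polarCoord_target]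
        refine setLIntegral_congr_fun (measurableSet_Ioi.prod measurableSet_Ioo) ?_
        rintro ⟨r, θ⟩ ⟨hr, hθ⟩
        have hr' : 0 < r := hr
        have hmem : polarCoord.symm (r, θ) ∈ Ioi (0 : ℝ) ×ˢ Ioi (0 : ℝ) ↔
            θ ∈ Ioo 0 (π / 2) := by
          rw [← cos_pos_and_sin_pos_iff hθ]
          simp [polarCoord_symm_apply, hr']
        have hsq : (r * cos θ) ^ 2 + (r * sin θ) ^ 2 = r ^ 2 := by
          linear_combination r ^ 2 * sin_sq_add_cos_sq θ
        beta_reduce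
        by_cases hc : θ ∈ Ioo 0 (π / 2)
        · rw [indicator_of_mem (hmem.2 hc), indicator_of_mem hc, polarCoord_symm_apply, hsq,
            smul_eq_mul, Pi.one_apply, mul_one]
        · rw [indicator_of_notMem (mt hmem.1 hc), indicator_of_notMem hc, smul_zero, mul_zero]
    _ = (∫⁻ r in Ioi (0 : ℝ), ENNReal.ofReal r * H (r ^ 2)) *
          ∫⁻ θ in Ioo (-π) π, (Ioo 0 (π / 2)).indicator 1 θ := by
        rw [Measure.volume_eq_prod, ← Measure.prod_restrict]
        refine lintegral_prod_mul (f := fun r : ℝ => ENNReal.ofReal r * H (r ^ 2))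
          (g := (Ioo 0 (π / 2)).indicator 1) ?_ ?_
        · fun_prop
        · exact (measurable_one.indicator measurableSet_Ioo).aemeasurable
    _ = _ := by
        rw [lintegral_indicator_one measurableSet_Ioo,
          Measure.restrict_apply measurableSet_Ioo, inter_eq_left.2
            (Ioo_subset_Ioo (by linarith [pi_pos]) (by linarith [pi_pos])),
          Real.volume_Ioo, sub_zero, mul_comm]

lemma tsum_int_of_even {a : ℤ → ℝ≥0∞} (ha : ∀ n, a (-n) = a n) :
    ∑' n : ℤ, a n = a 0 + 2 * ∑' n : ℕ, a (n + 1 : ℕ) := by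
  rw [tsum_of_nat_of_neg_add_one (f := a) ENNReal.summable ENNReal.summable,
    tsum_eq_zero_add' (f := fun n : ℕ => a n) ENNReal.summable]
  have : ∀ n : ℕ, a (-(n + 1 : ℤ)) = a (n + 1 : ℕ) := fun n => by rw [ha]; norm_cast
  simp only [this]
  push_cast
  ring

lemma tsum_int_int_radial (h : ℝ) (H : ℝ → ℝ≥0∞) :
    ∑' z : ℤ × ℤ, H ((h * z.1) ^ 2 + (h * z.2) ^ 2) =
      H 0 + 4 * ∑' n : ℕ, H ((h * (n + 1 : ℕ)) ^ 2) +
        4 * ∑' m : ℕ, ∑' n : ℕ, H ((h * (m + 1 : ℕ)) ^ 2 + (h * (n + 1 : ℕ)) ^ 2) := by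
  rw [ENNReal.tsum_prod (f := fun m n : ℤ => H ((h * m) ^ 2 + (h * n) ^ 2)),
    tsum_int_of_even (by intro n; simp)]
  have key : ∀ m : ℤ, ∑' n : ℤ, H ((h * m) ^ 2 + (h * n) ^ 2) =
      H ((h * m) ^ 2) + 2 * ∑' n : ℕ, H ((h * m) ^ 2 + (h * (n + 1 : ℕ)) ^ 2) := fun m => by
    rw [tsum_int_of_even (by intro n; simp)]
    simp
  simp only [key, ENNReal.tsum_add, ENNReal.tsum_mul_left]
  simp only [Int.cast_zero, mul_zero, ne_eq, OfNat.ofNat_ne_zero, not_false_eq_true, zero_pow,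
    zero_add, Int.cast_natCast]
  ring

lemma tsum_nat_nat_radial (h : ℝ) (H : ℝ → ℝ≥0∞) :
    ∑' m : ℕ, ∑' n : ℕ, H ((h * m) ^ 2 + (h * n) ^ 2) =
      H 0 + 2 * ∑' n : ℕ, H ((h * (n + 1 : ℕ)) ^ 2) +
        ∑' m : ℕ, ∑' n : ℕ, H ((h * (m + 1 : ℕ)) ^ 2 + (h * (n + 1 : ℕ)) ^ 2) := by
  have key : ∀ m : ℕ, ∑' n : ℕ, H ((h * m) ^ 2 + (h * n) ^ 2) =
      H ((h * m) ^ 2) + ∑' n : ℕ, H ((h * m) ^ 2 + (h * (n + 1 : ℕ)) ^ 2) := fun m => by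
    rw [tsum_eq_zero_add' ENNReal.summable]
    simp
  rw [tsum_eq_zero_add' ENNReal.summable]
  simp only [key, ENNReal.tsum_add]
  simp only [Nat.cast_zero, mul_zero, ne_eq, OfNat.ofNat_ne_zero, not_false_eq_true, zero_pow,
    zero_add]
  ring

/-- Comparison of a radial lattice sum over `h ℤ²` with the corresponding integral. -/
lemma radial_lattice_sum_sub_integral_le {h : ℝ} (hh : 0 < h) {G : ℝ → ℝ} (hG : Antitone G)
    (hG0 : ∀ s, 0 ≤ G s)
    (hint1 : IntegrableOn (fun t => G (t ^ 2) * t) (Ioi 0))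
    (hint2 : IntegrableOn (fun t => G (t ^ 2)) (Ioi 0)) :
    Summable (fun z : ℤ × ℤ => G ((h * z.1) ^ 2 + (h * z.2) ^ 2)) ∧
    |h ^ 2 * (∑' z : ℤ × ℤ, G ((h * z.1) ^ 2 + (h * z.2) ^ 2)) -
        2 * π * ∫ t in Ioi (0 : ℝ), G (t ^ 2) * t| ≤
      4 * h * (∫ t in Ioi (0 : ℝ), G (t ^ 2)) + 3 * h ^ 2 * G 0 := by
  set H : ℝ → ℝ≥0∞ := fun s => ENNReal.ofReal (G s) with hHdef
  have hH : Antitone H := fun a b hab => ENNReal.ofReal_le_ofReal (hG hab)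
  set A := ∑' m : ℕ, ∑' n : ℕ, H ((h * (m + 1 : ℕ)) ^ 2 + (h * (n + 1 : ℕ)) ^ 2) with hA
  set B := ∑' n : ℕ, H ((h * (n + 1 : ℕ)) ^ 2) with hB
  set I := ∫ t in Ioi (0 : ℝ), G (t ^ 2) with hI
  set J := ∫ t in Ioi (0 : ℝ), G (t ^ 2) * t with hJ
  have hI0 : 0 ≤ I := integral_nonneg fun t => hG0 _
  have hJ0 : 0 ≤ J := setIntegral_nonneg measurableSet_Ioi fun t ht =>
    mul_nonneg (hG0 _) (le_of_lt ht)
  have hIl : ∫⁻ t in Ioi (0 : ℝ), H (t ^ 2) = ENNReal.ofReal I :=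
    (ofReal_integral_eq_lintegral_ofReal hint2 (ae_of_all _ fun t => hG0 _)).symm
  have hJl : ∫⁻ t in Ioi (0 : ℝ), ENNReal.ofReal t * H (t ^ 2) = ENNReal.ofReal J := by
    rw [hJ, ofReal_integral_eq_lintegral_ofReal hint1]
    · refine setLIntegral_congr_fun measurableSet_Ioi fun t ht => ?_
      simp only [hHdef]
      rw [mul_comm, ENNReal.ofReal_mul (hG0 _)]
    · exact (ae_restrict_iff' measurableSet_Ioi).2 (ae_of_all _ fun t ht =>
        mul_nonneg (hG0 _) (le_of_lt ht))
  have hh' : ENNReal.ofReal h ≠ 0 := by simpa using hh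
  have hBI : ENNReal.ofReal h * B ≤ ENNReal.ofReal I := by
    rw [← hIl]
    have := tsum_succ_le_lintegral hh (antitoneOn_radial hH 0)
    simpa [hB] using this
  have hlow := lintegral_le_tsum_tsum hh hH
  have hupp := tsum_tsum_succ_le_lintegral hh hH
  rw [lintegral_quadrant_radial hH, hJl, ← ENNReal.ofReal_mul (by positivity)] at hlow hupp
  rw [tsum_nat_nat_radial] at hlow
  have hsum := tsum_int_int_radial h H
  rw [← hA] at hlow hupp hsum
  rw [← hB] at hlow hsum
  have hBtop : B ≠ ⊤ := fun hc => by
    rw [hc, ENNReal.mul_top hh'] at hBI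
    exact absurd hBI (by simp)
  have hAtop : A ≠ ⊤ := fun hc => by
    rw [hc, ENNReal.mul_top (pow_ne_zero 2 hh')] at hupp
    exact absurd hupp (by simp)
  have hHtop : H 0 ≠ ⊤ := ENNReal.ofReal_ne_top
  lift A to NNReal using hAtop with a
  lift B to NNReal using hBtop with b
  have hfin : ∑' z : ℤ × ℤ, H ((h * z.1) ^ 2 + (h * z.2) ^ 2) ≠ ⊤ := by
    rw [hsum]
    finiteness
  have hS : HasSum (fun z : ℤ × ℤ => G ((h * z.1) ^ 2 + (h * z.2) ^ 2)) (G 0 + 4 * b + 4 * a) := by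
    have h1 := ENNReal.hasSum_toReal hfin
    rw [← ENNReal.tsum_toReal_eq (fun _ => ENNReal.ofReal_ne_top), hsum] at h1
    simp only [hHdef, ENNReal.toReal_ofReal (hG0 _)] at h1
    convert h1 using 1
    rw [ENNReal.toReal_add (by finiteness) (by finiteness),
      ENNReal.toReal_add (by finiteness) (by finiteness)]
    simp [hG0]
  refine ⟨hS.summable, ?_⟩
  rw [hS.tsum_eq]
  have e1 : h * b ≤ I := by
    have := ENNReal.toReal_mono (by finiteness) hBI
    simpa [hh.le, hI0] using this
  have e2 : h ^ 2 * a ≤ π / 2 * J := by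
    have := ENNReal.toReal_mono (by finiteness) hupp
    rw [ENNReal.toReal_ofReal (by positivity)] at this
    simpa [hh.le] using this
  have e3 : π / 2 * J ≤ h ^ 2 * (G 0 + 2 * b + a) := by
    have := ENNReal.toReal_mono (by finiteness) hlow
    rw [ENNReal.toReal_ofReal (by positivity), ENNReal.toReal_mul,
      ENNReal.toReal_add (by finiteness) (by finiteness),
      ENNReal.toReal_add (by finiteness) (by finiteness)] at this
    simpa [hHdef, hG0, hh.le] using this
  have e4 : h * (h * b) ≤ h * I := mul_le_mul_of_nonneg_left e1 hh.le
  have e5 : 0 ≤ h ^ 2 * G 0 := mul_nonneg (by positivity) (hG0 0)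
  rw [abs_le]
  constructor <;> linarith

end LatticeSums

lemma integrableOn_Ioi_zero_of_eqOn {a : ℝ} (ha : 0 ≤ a) {u v w : ℝ → ℝ}
    (hv : IntegrableOn v (Ioo 0 a)) (hw : IntegrableOn w (Ioi a))
    (huv : EqOn u v (Ioo 0 a)) (huw : EqOn u w (Ioi a)) :
    IntegrableOn u (Ioi 0) ∧
      ∫ t in Ioi (0 : ℝ), u t = (∫ t in Ioo 0 a, v t) + ∫ t in Ioi a, w t := by
  have hu1 : IntegrableOn u (Ioc 0 a) :=
    (integrableOn_Ioc_iff_integrableOn_Ioo (by simp)).2 (hv.congr_fun huv.symm measurableSet_Ioo)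
  have hu2 : IntegrableOn u (Ioi a) := hw.congr_fun huw.symm measurableSet_Ioi
  rw [← Ioc_union_Ioi_eq_Ioi ha]
  refine ⟨hu1.union hu2, ?_⟩
  rw [setIntegral_union (Ioc_disjoint_Ioi le_rfl) measurableSet_Ioi hu1 hu2,
    integral_Ioc_eq_integral_Ioo, setIntegral_congr_fun measurableSet_Ioo huv,
    setIntegral_congr_fun measurableSet_Ioi huw]

theorem stmt_1 (L s₀ : ℝ) (hL : 0 < L) (hs₀ : 0 ≤ s₀) (f : ℝ → ℝ)
    (hf0 : ∀ t, s₀ ≤ t → 0 ≤ f t)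
    (hmono : ∀ s t, s₀ ≤ s → s ≤ t → f t ≤ f s)
    (hint1 : IntegrableOn (fun t => f (t ^ 2) * t) (Ioi (Real.sqrt s₀)))
    (hint2 : IntegrableOn (fun t => f (t ^ 2)) (Ioi (Real.sqrt s₀))) :
    Summable (fun z : ℤ × ℤ => if s₀ ≤ nsq (kvec L z) then f (nsq (kvec L z)) else 0) ∧
    |(1 / L ^ 2) * (∑' z : ℤ × ℤ, if s₀ ≤ nsq (kvec L z) then f (nsq (kvec L z)) else 0)
        - (1 / (2 * π)) * ∫ t in Ioi (Real.sqrt s₀), f (t ^ 2) * t| ≤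
      (2 / (π * L)) * (∫ t in Ioi (Real.sqrt s₀), f (t ^ 2))
        + (4 * Real.sqrt s₀ / (π * L) + 6 / L ^ 2) * f s₀ := by
  set R := √s₀ with hR
  have hR0 : 0 ≤ R := sqrt_nonneg _
  have hRsq : R ^ 2 = s₀ := sq_sqrt hs₀
  have hfs : 0 ≤ f s₀ := hf0 _ le_rfl
  set h := 2 * π / L with hh
  have hhpos : 0 < h := by positivity
  set G₁ : ℝ → ℝ := fun s => f (max s s₀) with hG₁
  set G₂ : ℝ → ℝ := fun s => if s < s₀ then f s₀ else 0 with hG₂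
  have hG₁anti : Antitone G₁ := fun a b hab =>
    hmono _ _ (le_max_right _ _) (max_le_max_right _ hab)
  have hG₂anti : Antitone G₂ := fun a b hab => by
    simp only [hG₂]
    split_ifs <;> first | exact le_rfl | exact hfs | (exfalso; linarith)
  have hG₁0 : ∀ s, 0 ≤ G₁ s := fun s => hf0 _ (le_max_right _ _)
  have hG₂0 : ∀ s, 0 ≤ G₂ s := fun s => by
    simp only [hG₂]
    split_ifs <;> first | exact le_rfl | exact hfs
  have hlt : ∀ t ∈ Ioo 0 R, t ^ 2 < s₀ := fun t ht => by
    rw [← hRsq]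
    exact pow_lt_pow_left₀ ht.2 ht.1.le two_ne_zero
  have hgt : ∀ t ∈ Ioi R, s₀ < t ^ 2 := fun t ht => by
    rw [← hRsq]
    exact pow_lt_pow_left₀ ht hR0 two_ne_zero
  have hG₁in : ∀ t ∈ Ioo 0 R, G₁ (t ^ 2) = f s₀ := fun t ht => by
    simp only [hG₁, max_eq_right (hlt t ht).le]
  have hG₁out : ∀ t ∈ Ioi R, G₁ (t ^ 2) = f (t ^ 2) := fun t ht => by
    simp only [hG₁, max_eq_left (hgt t ht).le]
  have hG₂in : ∀ t ∈ Ioo 0 R, G₂ (t ^ 2) = f s₀ := fun t ht => if_pos (hlt t ht)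
  have hG₂out : ∀ t ∈ Ioi R, G₂ (t ^ 2) = 0 := fun t ht => if_neg (hgt t ht).not_gt
  have hc : IntegrableOn (fun _ : ℝ => f s₀) (Ioo 0 R) := integrableOn_const (by simp)
  have hct : IntegrableOn (fun t : ℝ => f s₀ * t) (Ioo 0 R) :=
    (Continuous.integrableOn_Icc (by fun_prop)).mono_set Ioo_subset_Icc_self
  have hci : ∫ _ in Ioo 0 R, f s₀ = R * f s₀ := by simp [hR0]
  obtain ⟨i1, j1⟩ := integrableOn_Ioi_zero_of_eqOn (u := fun t => G₁ (t ^ 2)) hR0 hc hint2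
    hG₁in hG₁out
  obtain ⟨i2, j2⟩ := integrableOn_Ioi_zero_of_eqOn (u := fun t => G₁ (t ^ 2) * t) hR0 hct hint1
    (fun t ht => congrArg (· * t) (hG₁in t ht)) (fun t ht => congrArg (· * t) (hG₁out t ht))
  obtain ⟨i3, j3⟩ := integrableOn_Ioi_zero_of_eqOn (u := fun t => G₂ (t ^ 2)) hR0 hc
    integrableOn_zero hG₂in hG₂out
  obtain ⟨i4, j4⟩ := integrableOn_Ioi_zero_of_eqOn (u := fun t => G₂ (t ^ 2) * t) hR0 hct
    integrableOn_zero
    (fun t ht => congrArg (· * t) (hG₂in t ht))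
    (fun t ht => (congrArg (· * t) (hG₂out t ht)).trans (zero_mul t))
  obtain ⟨s1, b1⟩ := radial_lattice_sum_sub_integral_le hhpos hG₁anti hG₁0 i2 i1
  obtain ⟨s2, b2⟩ := radial_lattice_sum_sub_integral_le hhpos hG₂anti hG₂0 i4 i3
  have hsummand : (fun z : ℤ × ℤ => if s₀ ≤ nsq (kvec L z) then f (nsq (kvec L z)) else 0) =
      fun z : ℤ × ℤ => G₁ ((h * z.1) ^ 2 + (h * z.2) ^ 2) -
        G₂ ((h * z.1) ^ 2 + (h * z.2) ^ 2) := by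
    funext z
    have hz : nsq (kvec L z) = (h * z.1) ^ 2 + (h * z.2) ^ 2 := rfl
    simp only [hz, hG₁, hG₂]
    split_ifs with p q q
    · exfalso; linarith
    · rw [max_eq_left p, sub_zero]
    · rw [max_eq_right q.le, sub_self]
    · exfalso; linarith
  rw [hsummand]
  refine ⟨s1.sub s2, ?_⟩
  rw [s1.tsum_sub s2]
  have hG₁z : G₁ 0 = f s₀ := by simp only [hG₁, max_eq_right hs₀]
  have hG₂z : G₂ 0 ≤ f s₀ := by
    simp only [hG₂]
    split_ifs <;> first | exact le_rfl | exact hfs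
  rw [j1, j2, hci, hG₁z] at b1
  rw [j3, j4, hci] at b2
  simp only [integral_zero, add_zero] at b2
  generalize (∑' z : ℤ × ℤ, G₁ ((h * z.1) ^ 2 + (h * z.2) ^ 2)) = S₁ at *
  generalize (∑' z : ℤ × ℤ, G₂ ((h * z.1) ^ 2 + (h * z.2) ^ 2)) = S₂ at *
  generalize (∫ t in Ioi R, f (t ^ 2)) = I at *
  generalize (∫ t in Ioi R, f (t ^ 2) * t) = J at *
  generalize (∫ t in Ioo 0 R, f s₀ * t) = K at *
  have hL' : L = 2 * π / h := by rw [hh]; field_simp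
  have e5 : h ^ 2 * G₂ 0 ≤ h ^ 2 * f s₀ := mul_le_mul_of_nonneg_left hG₂z (by positivity)
  have hb : |h ^ 2 * (S₁ - S₂) - 2 * π * J| ≤
      4 * h * I + (8 * h * R + 6 * h ^ 2) * f s₀ := by
    rw [abs_le] at *
    constructor <;> linarith [b1.1, b1.2, b2.1, b2.2]
  have hl : 1 / L ^ 2 * (S₁ - S₂) - 1 / (2 * π) * J =
      1 / (4 * π ^ 2) * (h ^ 2 * (S₁ - S₂) - 2 * π * J) := by
    rw [hh]
    field_simp
    ring
  have hr : 2 / (π * L) * I + (4 * R / (π * L) + 6 / L ^ 2) * f s₀ =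
      1 / (4 * π ^ 2) * (4 * h * I + (8 * h * R + 6 * h ^ 2) * f s₀) := by
    rw [hh]
    field_simp
    ring
  rw [hl, hr, abs_mul, abs_of_pos (by positivity : 0 < 1 / (4 * π ^ 2))]
  exact mul_le_mul_of_nonneg_left hb (by positivity)
end

section
/- For all L > 0, μ > 0 and all real numbers b > a ≥ 0: | (1/L²) card{k ∈ Λ_L : aμ ≤ |k|² < bμ} − (b−a)μ/(4π) | ≤ (2/(πL))(√(aμ) + √(bμ)) + 6/L². -/
open Real MeasureTheory Set

theorem integral_zero_one_sqrt_one_sub_sq : ∫ x in (0 : ℝ)..1, √(1 - x ^ 2) = π / 4 := by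
  have hc : Continuous fun x : ℝ => √(1 - x ^ 2) := by fun_prop
  have h := intervalIntegral.integral_add_adjacent_intervals
    (hc.intervalIntegrable (μ := volume) (-1) 0) (hc.intervalIntegrable 0 1)
  have h2 := intervalIntegral.integral_comp_neg (a := 0) (b := 1) fun x : ℝ => √(1 - x ^ 2)
  simp only [even_two.neg_pow, neg_zero] at h2
  rw [integral_sqrt_one_sub_sq] at h
  linarith

theorem integral_sqrt_sq_sub_sq {R K : ℝ} (hR : 0 < R) (hK : R ≤ K) :
    ∫ x in (0 : ℝ)..K, √(R ^ 2 - x ^ 2) = π * R ^ 2 / 4 := by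
  have hc : Continuous fun x : ℝ => √(1 - x ^ 2) := by fun_prop
  have hg : (fun x : ℝ => √(R ^ 2 - x ^ 2)) = fun x => R * √(1 - (x / R) ^ 2) := by
    ext x
    nth_rw 2 [← Real.sqrt_sq hR.le]
    rw [← Real.sqrt_mul (sq_nonneg R)]
    congr 1
    field_simp
  have h0 : ∫ x in (1 : ℝ)..(K / R), √(1 - x ^ 2) = 0 := by
    rw [intervalIntegral.integral_congr (g := fun _ => (0 : ℝ))]
    · simp
    · intro x hx
      rw [uIcc_of_le ((one_le_div hR).2 hK)] at hx
      exact Real.sqrt_eq_zero_of_nonpos (by nlinarith [hx.1])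
  rw [hg, intervalIntegral.integral_const_mul,
    intervalIntegral.integral_comp_div (fun x => √(1 - x ^ 2)) hR.ne', zero_div,
    ← intervalIntegral.integral_add_adjacent_intervals
      (hc.intervalIntegrable (μ := volume) 0 1) (hc.intervalIntegrable 1 (K / R)),
    h0, integral_zero_one_sqrt_one_sub_sq, smul_eq_mul]
  ring

theorem sum_range_sqrt_sq_sub_sq_mem_Icc {R : ℝ} (hR : 0 < R) :
    ∑ i ∈ Finset.range ⌈R⌉₊, √(R ^ 2 - (i : ℝ) ^ 2) ∈
      Icc (π * R ^ 2 / 4) (π * R ^ 2 / 4 + R) := by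
  have hanti : AntitoneOn (fun x : ℝ => √(R ^ 2 - x ^ 2)) (Icc 0 (0 + (⌈R⌉₊ : ℝ))) := by
    intro x hx y hy hxy
    exact Real.sqrt_le_sqrt (by nlinarith [hx.1])
  have h1 := hanti.integral_le_sum
  have h2 := hanti.sum_le_integral
  simp only [zero_add] at h1 h2
  rw [integral_sqrt_sq_sub_sq hR (Nat.le_ceil R)] at h1 h2
  refine ⟨h1, ?_⟩
  have h3 := Finset.sum_range_succ (fun i : ℕ => √(R ^ 2 - (i : ℝ) ^ 2)) ⌈R⌉₊
  rw [Finset.sum_range_succ'] at h3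
  have h4 : √(R ^ 2 - ((0 : ℕ) : ℝ) ^ 2) = R := by simp [Real.sqrt_sq hR.le]
  rw [h4] at h3
  have := Real.sqrt_nonneg (R ^ 2 - (⌈R⌉₊ : ℝ) ^ 2)
  linarith

theorem sum_Ioo_neg_of_even {F : ℤ → ℝ} (hF : ∀ m, F (-m) = F m) (n : ℕ) :
    ∑ m ∈ Finset.Ioo (-((n : ℤ) + 1)) (n + 1), F m =
      2 * ∑ i ∈ Finset.range (n + 1), F i - F 0 := by
  induction n with
  | zero =>
    have : Finset.Ioo (-(((0 : ℕ) : ℤ) + 1)) ((0 : ℕ) + 1) = {0} := by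
      ext m; simp only [Finset.mem_Ioo, Finset.mem_singleton]; omega
    rw [this]; simp; ring
  | succ n ih =>
    have : Finset.Ioo (-(((n + 1 : ℕ) : ℤ) + 1)) ((n + 1 : ℕ) + 1) =
        insert ((n : ℤ) + 1) (insert (-((n : ℤ) + 1)) (Finset.Ioo (-((n : ℤ) + 1)) (n + 1))) := by
      ext m; simp only [Finset.mem_Ioo, Finset.mem_insert]; omega
    rw [this, Finset.sum_insert, Finset.sum_insert, ih, hF, Finset.sum_range_succ _ (n + 1)]
    · push_cast; ring
    · simp
    · simp only [Finset.mem_Ioo, Finset.mem_insert]; omega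

theorem abs_sum_Ioo_two_mul_sqrt_sub_le {R : ℝ} (hR : 0 < R) :
    |∑ m ∈ Finset.Ioo (-⌈R⌉) ⌈R⌉, 2 * √(R ^ 2 - (m : ℝ) ^ 2) - π * R ^ 2| ≤ 2 * R := by
  obtain ⟨n, hn⟩ := Nat.exists_eq_succ_of_ne_zero (Nat.ceil_pos.2 hR).ne'
  have hK : ⌈R⌉ = (n : ℤ) + 1 := by
    rw [← Int.natCast_ceil_eq_ceil hR.le, hn]; push_cast; rfl
  have h := sum_range_sqrt_sq_sub_sq_mem_Icc hR
  rw [hn, Nat.succ_eq_add_one] at h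
  have h0 : √(R ^ 2 - ((0 : ℤ) : ℝ) ^ 2) = R := by simp [Real.sqrt_sq hR.le]
  rw [← Finset.mul_sum, hK,
    sum_Ioo_neg_of_even (F := fun m : ℤ => √(R ^ 2 - (m : ℝ) ^ 2)) (by simp) n, h0]
  simp only [Int.cast_natCast]
  rw [abs_le]
  constructor <;> linarith [h.1, h.2]

/-- The integer points of the open disc of radius `R` centred at the origin. -/
noncomputable def intDisc (R : ℝ) : Finset (ℤ × ℤ) :=
  ((Finset.Ioo (-⌈R⌉) ⌈R⌉).sigma fun m =>
    Finset.Ioo (-⌈√(R ^ 2 - (m : ℝ) ^ 2)⌉) ⌈√(R ^ 2 - (m : ℝ) ^ 2)⌉).map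
      (Equiv.sigmaEquivProd ℤ ℤ).toEmbedding

theorem mem_Ioo_neg_ceil {x : ℝ} {m : ℤ} : m ∈ Finset.Ioo (-⌈x⌉) ⌈x⌉ ↔ |(m : ℝ)| < x := by
  rw [Finset.mem_Ioo, neg_lt, Int.lt_ceil, Int.lt_ceil, abs_lt, neg_lt]
  push_cast
  rfl

theorem mem_intDisc {R : ℝ} (hR : 0 ≤ R) {z : ℤ × ℤ} :
    z ∈ intDisc R ↔ (z.1 : ℝ) ^ 2 + (z.2 : ℝ) ^ 2 < R ^ 2 := by
  have : z ∈ intDisc R ↔ |(z.1 : ℝ)| < R ∧ |(z.2 : ℝ)| < √(R ^ 2 - (z.1 : ℝ) ^ 2) := by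
    rw [intDisc, Finset.mem_map_equiv, Finset.mem_sigma, mem_Ioo_neg_ceil, mem_Ioo_neg_ceil]
    rfl
  rw [this, Real.lt_sqrt (abs_nonneg _), sq_abs, lt_sub_iff_add_lt']
  refine ⟨And.right, fun h => ⟨?_, h⟩⟩
  exact abs_lt_of_sq_lt_sq (by nlinarith [sq_nonneg (z.2 : ℝ)]) hR

theorem abs_card_Ioo_neg_ceil_sub_le {x : ℝ} (hx : 0 < x) :
    |((Finset.Ioo (-⌈x⌉) ⌈x⌉).card : ℝ) - 2 * x| ≤ 1 := by
  have hpos : 0 < ⌈x⌉ := Int.ceil_pos.2 hx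
  have h : ((Finset.Ioo (-⌈x⌉) ⌈x⌉).card : ℤ) = 2 * ⌈x⌉ - 1 := by
    rw [Int.card_Ioo]; omega
  have h' : ((Finset.Ioo (-⌈x⌉) ⌈x⌉).card : ℝ) = 2 * (⌈x⌉ : ℝ) - 1 := by exact_mod_cast h
  rw [h', abs_le]
  constructor <;> linarith [Int.le_ceil x, Int.ceil_lt_add_one x]

theorem abs_card_intDisc_sub_le {R : ℝ} (hR : 0 ≤ R) :
    |((intDisc R).card : ℝ) - π * R ^ 2| ≤ 4 * R + 1 := by
  rcases hR.eq_or_lt with rfl | hR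
  · simp [intDisc]
  have hcol : |((intDisc R).card : ℝ) -
      ∑ m ∈ Finset.Ioo (-⌈R⌉) ⌈R⌉, 2 * √(R ^ 2 - (m : ℝ) ^ 2)| ≤ 2 * R + 1 := by
    rw [intDisc, Finset.card_map, Finset.card_sigma, Nat.cast_sum, ← Finset.sum_sub_distrib]
    refine (Finset.abs_sum_le_sum_abs _ _).trans ?_
    refine (Finset.sum_le_card_nsmul _ _ 1 fun m hm => ?_).trans ?_
    · refine abs_card_Ioo_neg_ceil_sub_le (Real.sqrt_pos.2 ?_)
      have := mem_Ioo_neg_ceil.1 hm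
      rw [← sq_abs (m : ℝ)]
      nlinarith [abs_nonneg (m : ℝ)]
    · rw [nsmul_one]
      linarith [(abs_le.1 (abs_card_Ioo_neg_ceil_sub_le hR)).2]
  have := abs_sub_le ((intDisc R).card : ℝ)
    (∑ m ∈ Finset.Ioo (-⌈R⌉) ⌈R⌉, 2 * √(R ^ 2 - (m : ℝ) ^ 2)) (π * R ^ 2)
  linarith [abs_sum_Ioo_two_mul_sqrt_sub_le hR]

theorem abs_card_annulus_sub_le {r R : ℝ} (hr : 0 ≤ r) (hrR : r ≤ R) :
    |(Nat.card {z : ℤ × ℤ // r ^ 2 ≤ (z.1 : ℝ) ^ 2 + (z.2 : ℝ) ^ 2 ∧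
        (z.1 : ℝ) ^ 2 + (z.2 : ℝ) ^ 2 < R ^ 2} : ℝ) - π * (R ^ 2 - r ^ 2)| ≤
      4 * (r + R) + 2 := by
  have hR := hr.trans hrR
  have hsub : intDisc r ⊆ intDisc R := fun z hz => by
    rw [mem_intDisc hr] at hz
    rw [mem_intDisc hR]
    nlinarith
  have hcard : Nat.card {z : ℤ × ℤ // r ^ 2 ≤ (z.1 : ℝ) ^ 2 + (z.2 : ℝ) ^ 2 ∧
      (z.1 : ℝ) ^ 2 + (z.2 : ℝ) ^ 2 < R ^ 2} = (intDisc R \ intDisc r).card := by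
    refine Nat.subtype_card _ fun z => ?_
    rw [Finset.mem_sdiff, mem_intDisc hR, mem_intDisc hr, not_lt, and_comm]
  rw [hcard, Finset.cast_card_sdiff hsub]
  have h1 := abs_le.1 (abs_card_intDisc_sub_le hr)
  have h2 := abs_le.1 (abs_card_intDisc_sub_le hR)
  rw [abs_le]
  constructor <;> linarith [h1.1, h1.2, h2.1, h2.2]

theorem stmt_2 (L μ a b : ℝ) (hL : 0 < L) (hμ : 0 < μ) (ha : 0 ≤ a) (hab : a < b) :
    |(1 / L ^ 2) *
        (Nat.card {z : ℤ × ℤ // a * μ ≤ nsq (kvec L z) ∧ nsq (kvec L z) < b * μ} : ℝ)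
        - (b - a) * μ / (4 * π)| ≤
      (2 / (π * L)) * (Real.sqrt (a * μ) + Real.sqrt (b * μ)) + 6 / L ^ 2 := by
  have hπ := Real.pi_pos
  have hc : 0 < L / (2 * π) := by positivity
  have hsq : ∀ t, 0 ≤ t → (L / (2 * π) * √t) ^ 2 = (L / (2 * π)) ^ 2 * t := fun t ht => by
    rw [mul_pow, Real.sq_sqrt ht]
  have haμ : 0 ≤ a * μ := by positivity
  have hab' : a * μ ≤ b * μ := by gcongr
  have key := abs_card_annulus_sub_le (r := L / (2 * π) * √(a * μ)) (R := L / (2 * π) * √(b * μ))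
    (by positivity) (by gcongr)
  rw [hsq _ haμ, hsq _ (haμ.trans hab')] at key
  have hz : ∀ z : ℤ × ℤ,
      (z.1 : ℝ) ^ 2 + (z.2 : ℝ) ^ 2 = (L / (2 * π)) ^ 2 * nsq (kvec L z) := fun z => by
    simp only [nsq, kvec]
    field_simp
  have hc2 : 0 < (L / (2 * π)) ^ 2 := by positivity
  simp only [hz, mul_le_mul_iff_right₀ hc2, mul_lt_mul_iff_right₀ hc2] at key
  set N : ℝ := (Nat.card {z : ℤ × ℤ // a * μ ≤ nsq (kvec L z) ∧ nsq (kvec L z) < b * μ} : ℝ)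
  have hfac : 1 / L ^ 2 * N - (b - a) * μ / (4 * π) = 1 / L ^ 2 *
      (N - π * ((L / (2 * π)) ^ 2 * (b * μ) - (L / (2 * π)) ^ 2 * (a * μ))) := by
    field_simp
    ring
  have hL2 : 0 < 1 / L ^ 2 := by positivity
  rw [hfac, abs_mul, abs_of_pos hL2]
  calc _ ≤ 1 / L ^ 2 * (4 * (L / (2 * π) * √(a * μ) + L / (2 * π) * √(b * μ)) + 6) := by
        gcongr
        linarith
    _ = _ := by
        field_simp
        ring
end

section
/- For all M > 0, L > 0, E_B < 0, μ > 0, q ∈ ℝ² and τ > −μ, the function k ↦ 1/(m|k|² + |E_B|) − χ_{(μ,∞)}(|k|²)/((1/M)|q−k|² + |k|² + τ) is absolutely summable over the lattice Λ_L, so that G(q,τ) is a well-defined real number. -/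
open Real MeasureTheory Set

/-- `χ_{(μ,∞)}(s)`. -/
noncomputable def chi (μ s : ℝ) : ℝ := if μ < s then 1 else 0

/-- The function `G(q,τ)` (with `m = 1 + 1/M`). -/
noncomputable def Gfun (M L E_B μ : ℝ) (q : ℝ × ℝ) (τ : ℝ) : ℝ :=
  (1 / L ^ 2) * ∑' z : ℤ × ℤ,
    (1 / ((1 + 1 / M) * nsq (kvec L z) + |E_B|)
      - chi μ (nsq (kvec L z)) / ((1 / M) * nsq (q - kvec L z) + nsq (kvec L z) + τ))

/-- The free Fermi energy `E₀(μ) = Σ_{|k|² ≤ μ} |k|²`. -/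
noncomputable def E0 (L μ : ℝ) : ℝ :=
  ∑' z : ℤ × ℤ, if nsq (kvec L z) ≤ μ then nsq (kvec L z) else 0

/-- The particle number `N(μ) = card{k ∈ Λ_L : |k|² ≤ μ}`. -/
noncomputable def Nmu (L μ : ℝ) : ℕ := Nat.card {z : ℤ × ℤ // nsq (kvec L z) ≤ μ}

/-- `e` solves the polaron equation. -/
def PolaronEq (M L E_B μ e : ℝ) : Prop :=
  e = -((1 / L ^ 2) * ∑' z : ℤ × ℤ,
    if nsq (kvec L z) ≤ μ then
      1 / Gfun M L E_B μ (kvec L z) (-(nsq (kvec L z)) - e) else 0)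

/-- `‖z‖⁻³` is summable over the lattice `ℤ²`. -/
theorem summable_inv_norm_cube_int_prod : Summable fun z : ℤ × ℤ => (‖z‖ ^ 3)⁻¹ := by
  have h := EisensteinSeries.summable_one_div_norm_rpow (k := 3) (by norm_num)
  rw [← (finTwoArrowEquiv ℤ).symm.summable_iff] at h
  refine h.congr fun z => ?_
  have hz : ‖(finTwoArrowEquiv ℤ).symm z‖ = ‖z‖ := by
    refine le_antisymm ?_ ?_
    · refine (pi_norm_le_iff_of_nonneg (norm_nonneg _)).2 fun i => ?_
      fin_cases i
      · exact norm_fst_le z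
      · exact norm_snd_le z
    · exact norm_prod_le_iff.2
        ⟨norm_le_pi_norm ((finTwoArrowEquiv ℤ).symm z) 0,
          norm_le_pi_norm ((finTwoArrowEquiv ℤ).symm z) 1⟩
  simp only [Function.comp_apply, hz]
  rw [Real.rpow_neg (norm_nonneg _)]
  norm_cast

theorem nsq_nonneg (v : ℝ × ℝ) : 0 ≤ nsq v := by
  unfold nsq
  positivity

theorem abs_fst_le_sqrt_nsq (v : ℝ × ℝ) : |v.1| ≤ √(nsq v) :=
  Real.abs_le_sqrt (by unfold nsq; nlinarith [sq_nonneg v.2])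

theorem abs_snd_le_sqrt_nsq (v : ℝ × ℝ) : |v.2| ≤ √(nsq v) :=
  Real.abs_le_sqrt (by unfold nsq; nlinarith [sq_nonneg v.1])

theorem mul_norm_le_sqrt_nsq_kvec {L : ℝ} (hL : 0 < L) (z : ℤ × ℤ) :
    2 * Real.pi / L * ‖z‖ ≤ √(nsq (kvec L z)) := by
  have ha : 0 < 2 * Real.pi / L := by positivity
  have h1 := abs_fst_le_sqrt_nsq (kvec L z)
  have h2 := abs_snd_le_sqrt_nsq (kvec L z)
  simp only [kvec, abs_mul, abs_of_pos ha] at h1 h2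
  rw [Prod.norm_def, mul_max_of_nonneg _ _ ha.le, Int.norm_eq_abs, Int.norm_eq_abs]
  exact max_le h1 h2

theorem abs_nsq_sub_sub_nsq_le (q k : ℝ × ℝ) :
    |nsq (q - k) - nsq k| ≤ nsq q + 2 * (|q.1| + |q.2|) * √(nsq k) := by
  have e : nsq (q - k) - nsq k = nsq q - 2 * (q.1 * k.1 + q.2 * k.2) := by
    simp only [nsq, Prod.fst_sub, Prod.snd_sub]
    ring
  have h1 : |q.1 * k.1| ≤ |q.1| * √(nsq k) := by
    rw [abs_mul]
    exact mul_le_mul_of_nonneg_left (abs_fst_le_sqrt_nsq k) (abs_nonneg _)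
  have h2 : |q.2 * k.2| ≤ |q.2| * √(nsq k) := by
    rw [abs_mul]
    exact mul_le_mul_of_nonneg_left (abs_snd_le_sqrt_nsq k) (abs_nonneg _)
  have h0 := nsq_nonneg q
  rw [abs_le] at h1 h2
  rw [e, abs_le]
  constructor <;> nlinarith

/-- The difference of the two resolvents decays like `|k|⁻³`. -/
theorem abs_one_div_sub_one_div_le {M e τ : ℝ} (hM : 0 < M) (he : 0 ≤ e) (q k : ℝ × ℝ)
    (hk : 1 ≤ √(nsq k)) (hτ : 2 * |τ| ≤ nsq k) :
    |1 / ((1 + 1 / M) * nsq k + e) - 1 / ((1 / M) * nsq (q - k) + nsq k + τ)| ≤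
      2 * ((1 / M) * (nsq q + 2 * (|q.1| + |q.2|)) + |τ| + e) / √(nsq k) ^ 3 := by
  set r := √(nsq k)
  have hs : nsq k = r ^ 2 := (Real.sq_sqrt (nsq_nonneg k)).symm
  have hM' : 0 < 1 / M := by positivity
  have hr : 0 < r := by linarith
  have hD1 : r ^ 2 ≤ (1 + 1 / M) * nsq k + e := by
    rw [hs]
    nlinarith [mul_pos hM' (pow_pos hr 2)]
  have hD2 : r ^ 2 / 2 ≤ (1 / M) * nsq (q - k) + nsq k + τ := by
    nlinarith [mul_nonneg hM'.le (nsq_nonneg (q - k)), neg_abs_le τ]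
  have hr2 : 0 < r ^ 2 := by positivity
  rw [div_sub_div _ _ (by linarith) (by linarith), abs_div]
  have hnum : |1 * ((1 / M) * nsq (q - k) + nsq k + τ) - ((1 + 1 / M) * nsq k + e) * 1| ≤
      ((1 / M) * (nsq q + 2 * (|q.1| + |q.2|)) + |τ| + e) * r := by
    have heq : 1 * ((1 / M) * nsq (q - k) + nsq k + τ) - ((1 + 1 / M) * nsq k + e) * 1 =
        (1 / M) * (nsq (q - k) - nsq k) + (τ - e) := by ring
    have hb : |nsq (q - k) - nsq k| ≤ (nsq q + 2 * (|q.1| + |q.2|)) * r := by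
      nlinarith [abs_nsq_sub_sub_nsq_le q k, nsq_nonneg q]
    have hc : |τ - e| ≤ (|τ| + e) * r := by
      have := abs_sub τ e
      rw [abs_of_nonneg he] at this
      nlinarith [abs_nonneg τ]
    rw [heq]
    refine (abs_add_le _ _).trans ?_
    rw [abs_mul, abs_of_pos hM']
    nlinarith [mul_le_mul_of_nonneg_left hb hM'.le]
  have hden : r ^ 2 * (r ^ 2 / 2) ≤
      |((1 + 1 / M) * nsq k + e) * ((1 / M) * nsq (q - k) + nsq k + τ)| :=
    (mul_le_mul hD1 hD2 (by positivity) (by linarith)).trans (le_abs_self _)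
  calc _ ≤ ((1 / M) * (nsq q + 2 * (|q.1| + |q.2|)) + |τ| + e) * r / (r ^ 2 * (r ^ 2 / 2)) :=
        div_le_div₀ ((abs_nonneg _).trans hnum) hnum (by positivity) hden
    _ = _ := by
        field_simp

theorem stmt_3 (M L E_B μ τ : ℝ) (q : ℝ × ℝ)
    (hM : 0 < M) (hL : 0 < L) (hEB : E_B < 0) (hμ : 0 < μ) (hτ : -μ < τ) :
    Summable (fun z : ℤ × ℤ =>
      1 / ((1 + 1 / M) * nsq (kvec L z) + |E_B|)
        - chi μ (nsq (kvec L z)) / ((1 / M) * nsq (q - kvec L z) + nsq (kvec L z) + τ)) := by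
  have ha : 0 < 2 * Real.pi / L := by positivity
  set C := 2 * ((1 / M) * (nsq q + 2 * (|q.1| + |q.2|)) + |τ| + |E_B|)
  have hC : 0 ≤ C := by
    have := nsq_nonneg q
    positivity
  refine Summable.of_norm_bounded_eventually
    (summable_inv_norm_cube_int_prod.mul_left (C / (2 * Real.pi / L) ^ 3)) ?_
  have hn : Filter.Tendsto (fun z : ℤ × ℤ => 2 * Real.pi / L * ‖z‖) Filter.cofinite
      Filter.atTop := by
    rw [← Filter.cocompact_eq_cofinite]
    exact (tendsto_norm_cocompact_atTop).const_mul_atTop ha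
  filter_upwards [hn.eventually_ge_atTop (1 + μ + 2 * |τ|)] with z hz
  have hle := mul_norm_le_sqrt_nsq_kvec hL z
  have hsq := Real.sq_sqrt (nsq_nonneg (kvec L z))
  have hτ0 := abs_nonneg τ
  have hk : 1 ≤ √(nsq (kvec L z)) := by linarith
  have hs : 1 + μ + 2 * |τ| ≤ nsq (kvec L z) := by nlinarith
  have hchi : chi μ (nsq (kvec L z)) = 1 := if_pos (by linarith)
  rw [hchi, Real.norm_eq_abs]
  refine (abs_one_div_sub_one_div_le hM (abs_nonneg E_B) q _ hk (by linarith)).trans ?_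
  have hpos : 0 < 2 * Real.pi / L * ‖z‖ := by linarith
  calc C / √(nsq (kvec L z)) ^ 3 ≤ C / (2 * Real.pi / L * ‖z‖) ^ 3 := by gcongr
    _ = _ := by rw [mul_pow, ← div_div, div_eq_mul_inv _ (‖z‖ ^ 3)]
end

section
/- For every M > 1 there exist constants c₀, C > 0 such that for all L > 0, μ > 0, E_B < 0, q ∈ ℝ² and τ > −μ with L²|E_B| ≥ 1 and μ/|E_B| ≥ c₀: | G(q,τ) − (1/(4πm)) log( (|q|²/(M+1) + mμ + τ)/|E_B| ) | ≤ C ( 1 + μ/((μ+τ) log(μ/|E_B|)) )³. -/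
open Real MeasureTheory Set

/-- Error of replacing the integral of an even unimodal function over `[x, x + 1]`
by the value at `x`, in terms of an antiderivative. -/
lemma abs_sub_increment_bounds {φ Φ : ℝ → ℝ} (hΦ : ∀ x, HasDerivAt Φ (φ x) x)
    (heven : ∀ x, φ (-x) = φ x) (hanti : AntitoneOn φ (Ici 0)) (hnn : ∀ x, 0 ≤ φ x) (x : ℝ) :
    |φ x - (Φ (x + 1) - Φ x)| ≤ φ 0 ∧
    (0 ≤ x → |φ x - (Φ (x + 1) - Φ x)| ≤ φ x - φ (x + 1)) ∧
    (x + 1 ≤ 0 → |φ x - (Φ (x + 1) - Φ x)| ≤ φ (x + 1) - φ x) := by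
  have hmax : ∀ y, φ y ≤ φ 0 := by
    intro y
    rcases le_total 0 y with h | h
    · exact hanti (mem_Ici.2 le_rfl) (mem_Ici.2 h) h
    · rw [← heven y]
      exact hanti (mem_Ici.2 le_rfl) (mem_Ici.2 (by linarith)) (by linarith)
  obtain ⟨ξ, ⟨h1, h2⟩, hξ⟩ := exists_hasDerivAt_eq_slope Φ φ (by linarith : x < x + 1)
    (fun y _ => (hΦ y).continuousAt.continuousWithinAt) (fun y _ => hΦ y)
  rw [show x + 1 - x = 1 by ring, div_one] at hξ
  rw [← hξ]
  refine ⟨?_, fun h => ?_, fun h => ?_⟩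
  · rw [abs_le]
    constructor <;> linarith [hmax x, hmax ξ, hnn x, hnn ξ]
  · have a1 := hanti (mem_Ici.2 h) (mem_Ici.2 (by linarith)) h1.le
    have a2 := hanti (mem_Ici.2 (by linarith : 0 ≤ ξ)) (mem_Ici.2 (by linarith)) h2.le
    rw [abs_le]; constructor <;> linarith
  · have a1 := hanti (mem_Ici.2 (by linarith : 0 ≤ -ξ)) (mem_Ici.2 (by linarith : 0 ≤ -x))
      (by linarith)
    have a2 := hanti (mem_Ici.2 (by linarith : 0 ≤ -(x + 1))) (mem_Ici.2 (by linarith : 0 ≤ -ξ))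
      (by linarith)
    rw [heven, heven] at a1 a2
    rw [abs_le]; constructor <;> linarith

/-- The total error in comparing the sum of an even unimodal function over a shifted copy of `ℤ`
with its integral. -/
lemma summable_cell_error {φ Φ : ℝ → ℝ} (hΦ : ∀ x, HasDerivAt Φ (φ x) x)
    (heven : ∀ x, φ (-x) = φ x) (hanti : AntitoneOn φ (Ici 0)) (hnn : ∀ x, 0 ≤ φ x) (p : ℝ) :
    Summable (fun z : ℤ => |φ (z - p) - (Φ (z - p + 1) - Φ (z - p))|) ∧
    ∑' z : ℤ, |φ (z - p) - (Φ (z - p + 1) - Φ (z - p))| ≤ 3 * φ 0 := by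
  have key := abs_sub_increment_bounds hΦ heven hanti hnn
  set e : ℝ → ℝ := fun x => |φ x - (Φ (x + 1) - Φ x)| with he
  have he0 : ∀ x, 0 ≤ e x := fun x => abs_nonneg _
  set θ : ℝ := ⌈p⌉ - p with hθ
  have hθ0 : 0 ≤ θ := by linarith [Int.le_ceil p]
  have hθ1 : θ < 1 := by linarith [Int.ceil_lt_add_one p]
  have hmax : φ θ ≤ φ 0 := hanti (mem_Ici.2 le_rfl) (mem_Ici.2 hθ0) hθ0
  have hmax' : φ (-1 + θ) ≤ φ 0 := by
    rw [← heven]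
    exact hanti (mem_Ici.2 le_rfl) (mem_Ici.2 (by linarith)) (by linarith)
  have hpos : ∀ N : ℕ, ∑ i ∈ Finset.range N, e ((i : ℝ) + θ) ≤ φ 0 - φ (N + θ) := by
    intro N
    induction N with
    | zero => simp [hmax]
    | succ N ih =>
      rw [Finset.sum_range_succ]
      have := (key (N + θ)).2.1 (by positivity)
      have h2 : ((N + 1 : ℕ) : ℝ) + θ = N + θ + 1 := by push_cast; ring
      rw [h2]
      simp only [he] at ih ⊢
      linarith
  have hneg : ∀ N : ℕ, ∑ i ∈ Finset.range (N + 1), e (-((i : ℝ) + 1) + θ)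
      ≤ 2 * φ 0 - φ (-((N : ℝ) + 1) + θ) := by
    intro N
    induction N with
    | zero =>
      have := (key (-1 + θ)).1
      simp only [he, zero_add, Finset.range_one, Finset.sum_singleton, Nat.cast_zero]
      linarith
    | succ N ih =>
      rw [Finset.sum_range_succ]
      have h2 : -(((N + 1 : ℕ) : ℝ) + 1) + θ + 1 = -((N : ℝ) + 1) + θ := by push_cast; ring
      have := (key (-(((N + 1 : ℕ) : ℝ) + 1) + θ)).2.2 (by
        rw [h2]; have : (0 : ℝ) ≤ N := by positivity
        linarith)
      rw [h2] at this
      simp only [he] at ih ⊢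
      rw [h2]
      linarith
  have hpos' : ∀ N : ℕ, ∑ i ∈ Finset.range N, e ((i : ℝ) + θ) ≤ φ 0 := fun N =>
    (hpos N).trans (by linarith [hnn (N + θ)])
  have hneg' : ∀ N : ℕ, ∑ i ∈ Finset.range N, e (-((i : ℝ) + 1) + θ) ≤ 2 * φ 0 := fun N => by
    refine le_trans ?_ ((hneg N).trans (by linarith [hnn (-((N : ℝ) + 1) + θ)]))
    rw [Finset.sum_range_succ]
    linarith [he0 (-((N : ℝ) + 1) + θ)]
  have s1 := summable_of_sum_range_le (fun n => he0 _) hpos'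
  have s2 := summable_of_sum_range_le (fun n => he0 _) hneg'
  have t1 := Real.tsum_le_of_sum_range_le (fun n => he0 _) hpos'
  have t2 := Real.tsum_le_of_sum_range_le (fun n => he0 _) hneg'
  have H : HasSum (fun z : ℤ => e ((z : ℝ) + θ))
      (∑' n : ℕ, e ((n : ℝ) + θ) + ∑' n : ℕ, e (-((n : ℝ) + 1) + θ)) := by
    apply HasSum.of_nat_of_neg_add_one
    · simpa using s1.hasSum
    · simpa using s2.hasSum
  have H' : HasSum (fun z : ℤ => e ((z : ℝ) - p))
      (∑' n : ℕ, e ((n : ℝ) + θ) + ∑' n : ℕ, e (-((n : ℝ) + 1) + θ)) := by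
    rw [← (Equiv.addRight ⌈p⌉).hasSum_iff]
    convert H using 2 with z
    simp only [Function.comp, Equiv.coe_addRight, hθ]
    congr 1
    push_cast
    ring
  exact ⟨H'.summable, by rw [H'.tsum_eq]; linarith⟩

/-- Telescoping sums over `ℤ`. -/
lemma tsum_int_telescope {Ψ : ℝ → ℝ} {l₁ l₂ : ℝ}
    (hs : Summable (fun z : ℤ => Ψ (z + 1) - Ψ z))
    (h₁ : Filter.Tendsto Ψ Filter.atTop (nhds l₁)) (h₂ : Filter.Tendsto Ψ Filter.atBot (nhds l₂)) :
    ∑' z : ℤ, (Ψ (z + 1) - Ψ z) = l₁ - l₂ := by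
  have inj1 : Function.Injective (fun n : ℕ => (n : ℤ)) := fun a b h => by simpa using h
  have inj2 : Function.Injective (fun n : ℕ => (-((n : ℤ) + 1))) := fun a b h => by simpa using h
  have s1 := hs.comp_injective inj1
  have s2 := hs.comp_injective inj2
  have c1 := s1.hasSum.tendsto_sum_nat
  have c2 := s2.hasSum.tendsto_sum_nat
  have d1 : ∀ N : ℕ, ∑ i ∈ Finset.range N, ((fun z : ℤ => Ψ (z + 1) - Ψ z) ∘
      (fun n : ℕ => (n : ℤ))) i = Ψ N - Ψ 0 := by
    intro N
    rw [← Nat.cast_zero, ← Finset.sum_range_sub (fun n : ℕ => Ψ n)]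
    simp
  have d2 : ∀ N : ℕ, ∑ i ∈ Finset.range N, ((fun z : ℤ => Ψ (z + 1) - Ψ z) ∘
      (fun n : ℕ => (-((n : ℤ) + 1)))) i = Ψ 0 - Ψ (-(N : ℝ)) := by
    intro N
    have := Finset.sum_range_sub' (fun n : ℕ => Ψ (-(n : ℝ))) N
    simp only [Nat.cast_zero, neg_zero] at this
    rw [← this]
    refine Finset.sum_congr rfl fun i _ => ?_
    simp
  simp only [d1] at c1
  simp only [d2] at c2
  have e1 := tendsto_nhds_unique c1
    ((h₁.comp tendsto_natCast_atTop_atTop).sub_const (Ψ 0))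
  have e2 := tendsto_nhds_unique c2
    ((h₂.comp (Filter.tendsto_neg_atTop_atBot.comp tendsto_natCast_atTop_atTop)).const_sub (Ψ 0))
  have H := HasSum.of_nat_of_neg_add_one (f := fun z : ℤ => Ψ (z + 1) - Ψ z) s1.hasSum s2.hasSum
  rw [H.tsum_eq, e1, e2]
  ring

/-- One-dimensional lattice sums of Lorentzians. -/
lemma tsum_lorentzian {b : ℝ} (hb : 0 < b) (p : ℝ) :
    Summable (fun z : ℤ => 1 / ((z - p) ^ 2 + b)) ∧
    |∑' z : ℤ, 1 / ((z - p) ^ 2 + b) - π / √b| ≤ 3 / b := by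
  have hsb : 0 < √b := Real.sqrt_pos.2 hb
  set φ : ℝ → ℝ := fun x => 1 / (x ^ 2 + b) with hφ
  set Φ : ℝ → ℝ := fun x => 1 / √b * Real.arctan (x / √b) with hΦdef
  have hΦ : ∀ x, HasDerivAt Φ (φ x) x := by
    intro x
    have := (((hasDerivAt_id x).div_const (√b)).arctan).const_mul (1 / √b)
    refine this.congr_deriv ?_
    change 1 / √b * (1 / (1 + (x / √b) ^ 2) * (1 / √b)) = 1 / (x ^ 2 + b)
    have h2 : √b ^ 2 = b := Real.sq_sqrt hb.le
    have h3 : x ^ 2 + b ≠ 0 := by positivity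
    field_simp
    rw [h2]
    ring
  have hanti : AntitoneOn φ (Ici 0) := by
    intro x hx y hy hxy
    simp only [hφ, mem_Ici] at *
    gcongr
  obtain ⟨s, t⟩ := summable_cell_error hΦ (fun x => by simp [hφ]) hanti
    (fun x => by simp only [hφ]; positivity) p
  have hmono : Monotone Φ := by
    intro x y hxy
    simp only [hΦdef]
    have := Real.arctan_strictMono.monotone (div_le_div_of_nonneg_right hxy hsb.le)
    gcongr
  set Ψ : ℝ → ℝ := fun x => Φ (x - p) with hΨ
  have l1 : Filter.Tendsto Ψ Filter.atTop (nhds (1 / √b * (π / 2))) := by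
    refine Filter.Tendsto.const_mul _ ?_
    refine (Real.tendsto_arctan_atTop.mono_right nhdsWithin_le_nhds).comp ?_
    exact (Filter.tendsto_atTop_add_const_right _ (-p) Filter.tendsto_id).atTop_div_const hsb
  have l2 : Filter.Tendsto Ψ Filter.atBot (nhds (1 / √b * (-(π / 2)))) := by
    refine Filter.Tendsto.const_mul _ ?_
    refine (Real.tendsto_arctan_atBot.mono_right nhdsWithin_le_nhds).comp ?_
    exact (Filter.tendsto_atBot_add_const_right _ (-p) Filter.tendsto_id).atBot_div_const hsb
  have hbd : ∀ x, |Φ x| ≤ 1 / √b * (π / 2) := by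
    intro x
    simp only [hΦdef, abs_mul]
    rw [abs_of_pos (by positivity : 0 < 1 / √b)]
    gcongr
    rw [abs_le]
    exact ⟨(Real.neg_pi_div_two_lt_arctan _).le, (Real.arctan_lt_pi_div_two _).le⟩
  have sΨ : Summable (fun z : ℤ => Ψ (z + 1) - Ψ z) := by
    have hnn : ∀ x : ℝ, 0 ≤ Ψ (x + 1) - Ψ x := fun x =>
      sub_nonneg.2 (hmono (by linarith))
    refine Summable.of_nat_of_neg_add_one ?_ ?_
    · refine summable_of_sum_range_le (c := 1 / √b * (π / 2) - Ψ 0) (fun n => hnn _) fun N => ?_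
      have := Finset.sum_range_sub (fun n : ℕ => Ψ n) N
      simp only [Nat.cast_zero, Nat.cast_add, Nat.cast_one] at this
      simp only [Int.cast_natCast]
      rw [this]
      linarith [(abs_le.1 (hbd (N - p))).2]
    · refine summable_of_sum_range_le (c := Ψ 0 + 1 / √b * (π / 2)) (fun n => hnn _) fun N => ?_
      have := Finset.sum_range_sub' (fun n : ℕ => Ψ (-(n : ℝ))) N
      simp only [Nat.cast_zero, neg_zero] at this
      have h3 : ∑ i ∈ Finset.range N, (Ψ ((-((i : ℤ) + 1) : ℤ) + 1) - Ψ ((-((i : ℤ) + 1) : ℤ)))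
          = Ψ 0 - Ψ (-(N : ℝ)) := by
        rw [← this]
        refine Finset.sum_congr rfl fun i _ => ?_
        simp
      rw [h3]
      linarith [(abs_le.1 (hbd (-N - p))).1]
  have tΨ := tsum_int_telescope sΨ l1 l2
  have hΨΦ : ∀ x : ℝ, Ψ (x + 1) - Ψ x = Φ (x - p + 1) - Φ (x - p) := fun x => by
    simp only [hΨ]; rw [show x + 1 - p = x - p + 1 by ring]
  have s' : Summable (fun z : ℤ => φ (z - p) - (Ψ (z + 1) - Ψ z)) := by
    simp only [hΨΦ]; exact s.of_abs
  have sφ : Summable (fun z : ℤ => φ (z - p)) := by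
    simpa using s'.add sΨ
  refine ⟨sφ, ?_⟩
  have h4 : ∑' z : ℤ, φ (z - p) - π / √b = ∑' z : ℤ, (φ (z - p) - (Ψ (z + 1) - Ψ z)) := by
    rw [sφ.tsum_sub sΨ, tΨ]
    ring
  have h5 : 3 * φ 0 = 3 / b := by simp [hφ, div_eq_mul_inv]
  change |∑' z : ℤ, φ (z - p) - π / √b| ≤ 3 / b
  rw [h4, ← h5]
  simp only [← hΨΦ] at s t
  exact (norm_tsum_le_tsum_norm (f := fun z : ℤ => φ (z - p) - (Ψ (z + 1) - Ψ z)) s).trans t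

lemma tsum_lorentzian_le {b : ℝ} (hb : 0 < b) (p : ℝ) :
    ∑' z : ℤ, 1 / ((z - p) ^ 2 + b) ≤ π / √b + 3 / b := by
  linarith [(abs_le.1 (tsum_lorentzian hb p).2).2]

lemma tendsto_arsinh_sub_log :
    Filter.Tendsto (fun x => arsinh x - Real.log x) Filter.atTop (nhds (Real.log 2)) := by
  have h1 : Filter.Tendsto (fun x : ℝ => Real.log (1 + √((x⁻¹) ^ 2 + 1))) Filter.atTop
      (nhds (Real.log (1 + √((0 : ℝ) ^ 2 + 1)))) := by
    refine Filter.Tendsto.log ?_ (by positivity)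
    exact (((tendsto_inv_atTop_zero.pow 2).add_const 1).sqrt).const_add 1
  have h2 : (1 : ℝ) + √((0 : ℝ) ^ 2 + 1) = 2 := by norm_num
  rw [h2] at h1
  refine h1.congr' ?_
  filter_upwards [Filter.eventually_gt_atTop 0] with x hx
  rw [arsinh, ← Real.log_div (by positivity) hx.ne']
  congr 1
  have : 1 + x ^ 2 = x ^ 2 * ((x⁻¹) ^ 2 + 1) := by field_simp
  rw [this, Real.sqrt_mul (by positivity), Real.sqrt_sq hx.le]
  field_simp

lemma tendsto_arsinh_sub_arsinh {a b : ℝ} (ha : 0 < a) (hb : 0 < b) (p : ℝ) :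
    Filter.Tendsto (fun x => arsinh (x / √a) - arsinh ((x - p) / √b)) Filter.atTop
      (nhds (Real.log (b / a) / 2)) := by
  have hsa : 0 < √a := Real.sqrt_pos.2 ha
  have hsb : 0 < √b := Real.sqrt_pos.2 hb
  have l1 : Filter.Tendsto (fun x : ℝ => x / √a) Filter.atTop Filter.atTop :=
    Filter.tendsto_id.atTop_div_const hsa
  have l2 : Filter.Tendsto (fun x : ℝ => (x - p) / √b) Filter.atTop Filter.atTop :=
    (Filter.tendsto_atTop_add_const_right _ (-p) Filter.tendsto_id).atTop_div_const hsb
  have t1 := tendsto_arsinh_sub_log.comp l1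
  have t2 := tendsto_arsinh_sub_log.comp l2
  have t3 : Filter.Tendsto (fun x : ℝ => Real.log (1 - p * x⁻¹)) Filter.atTop (nhds 0) := by
    have : Filter.Tendsto (fun x : ℝ => 1 - p * x⁻¹) Filter.atTop (nhds (1 - p * 0)) :=
      (tendsto_inv_atTop_zero.const_mul p).const_sub 1
    have := this.log (by norm_num)
    simpa using this
  have t4 := ((t1.sub t2).sub t3).add_const (Real.log (b / a) / 2)
  rw [sub_self, sub_zero, zero_add] at t4
  refine t4.congr' ?_
  filter_upwards [Filter.eventually_gt_atTop 0, Filter.eventually_gt_atTop p] with x hx hxp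
  have h1 : 1 - p * x⁻¹ = (x - p) / x := by field_simp
  have h2 : 0 < x - p := by linarith
  simp only [Function.comp]
  rw [h1, Real.log_div h2.ne' hx.ne', Real.log_div h2.ne' hsb.ne', Real.log_div hx.ne' hsa.ne',
    Real.log_div hb.ne' ha.ne', Real.log_sqrt ha.le, Real.log_sqrt hb.le]
  ring

lemma hasDerivAt_arsinh_div {a : ℝ} (ha : 0 < a) (x : ℝ) :
    HasDerivAt (fun x => arsinh (x / √a)) (1 / √(x ^ 2 + a)) x := by
  have hsa : 0 < √a := Real.sqrt_pos.2 ha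
  have h := ((hasDerivAt_id x).div_const (√a)).arsinh
  refine h.congr_deriv ?_
  have h2 : √a ^ 2 = a := Real.sq_sqrt ha.le
  have h3 : x ^ 2 + a = a * (1 + (x / √a) ^ 2) := by
    rw [div_pow, h2]; field_simp; ring
  rw [h3, Real.sqrt_mul ha.le]
  simp only [id, smul_eq_mul]
  have : 0 < √(1 + (x / √a) ^ 2) := by positivity
  field_simp

lemma summable_sqrt_cell_error {a : ℝ} (ha : 0 < a) (p : ℝ) :
    Summable (fun z : ℤ => |1 / √((z - p) ^ 2 + a) -
      (arsinh ((z - p + 1) / √a) - arsinh ((z - p) / √a))|) ∧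
    ∑' z : ℤ, |1 / √((z - p) ^ 2 + a) -
      (arsinh ((z - p + 1) / √a) - arsinh ((z - p) / √a))| ≤ 3 / √a := by
  have h := summable_cell_error (φ := fun x => 1 / √(x ^ 2 + a)) (Φ := fun x => arsinh (x / √a))
    (hasDerivAt_arsinh_div ha) (fun x => by simp) ?_ (fun x => by positivity) p
  · refine ⟨h.1, h.2.trans_eq ?_⟩
    simp [div_eq_mul_inv]
  · intro x hx y hy hxy
    simp only [mem_Ici] at *
    gcongr

lemma summable_lorentzian_diff {a b : ℝ} (ha : 0 < a) (hb : 0 < b) (p : ℝ × ℝ) :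
    Summable (fun z : ℤ × ℤ => 1 / ((z.1 : ℝ) ^ 2 + ((z.2 : ℝ) ^ 2 + a)) -
      1 / (((z.1 : ℝ) - p.1) ^ 2 + ((z.2 - p.2) ^ 2 + b))) := by
  have s1 : Summable (fun z : ℤ => (1 / ((z : ℝ) ^ 2 + 1)) ^ (3 / 4 : ℝ)) := by
    have h0 : Summable (fun n : ℕ => (1 / ((n : ℝ) ^ (3 / 2 : ℝ)))) :=
      Real.summable_one_div_nat_rpow.2 (by norm_num)
    have h1 : Summable (fun n : ℕ => (1 / ((n : ℝ) ^ 2 + 1)) ^ (3 / 4 : ℝ)) := by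
      rw [← summable_nat_add_iff 1] at h0 ⊢
      refine Summable.of_nonneg_of_le (fun n => by positivity) (fun n => ?_) h0
      have h2 : 1 / (((n + 1 : ℕ) : ℝ) ^ (3 / 2 : ℝ)) = (1 / (((n + 1 : ℕ) : ℝ) ^ 2)) ^ (3 / 4 : ℝ) := by
        rw [Real.div_rpow (by norm_num) (by positivity), Real.one_rpow, ← Real.rpow_natCast,
          ← Real.rpow_mul (by positivity)]
        norm_num
      rw [h2]
      gcongr
      linarith
    exact Summable.of_nat_of_neg (by simpa using h1) (by simpa using h1)
  have s2 := s1.mul_of_nonneg s1 (fun z => by positivity) (fun z => by positivity)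
  set P : ℝ := p.1 ^ 2 + p.2 ^ 2 with hP
  have hP0 : 0 ≤ P := by positivity
  set c₁ : ℝ := min 1 a with hc₁
  set c₂ : ℝ := min (1 / 2) (b / (1 + 2 * P)) with hc₂
  have hc₁0 : 0 < c₁ := by positivity
  have hc₂0 : 0 < c₂ := by positivity
  set K : ℝ := 2 * (|p.1| + |p.2|) + (P + b + a) with hK
  refine Summable.of_norm_bounded (s2.mul_left (K / (c₁ * c₂))) fun z => ?_
  obtain ⟨x, y⟩ := z
  dsimp only
  set u : ℝ := (x : ℝ)
  set v : ℝ := (y : ℝ)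
  have hA : c₁ * (1 + u ^ 2 + v ^ 2) ≤ u ^ 2 + (v ^ 2 + a) := by
    have h1 : c₁ ≤ 1 := min_le_left _ _
    have h2 : c₁ ≤ a := min_le_right _ _
    nlinarith [sq_nonneg u, sq_nonneg v]
  have hB : c₂ * (1 + u ^ 2 + v ^ 2) ≤ (u - p.1) ^ 2 + ((v - p.2) ^ 2 + b) := by
    have h1 : c₂ ≤ 1 / 2 := min_le_left _ _
    have h2 : c₂ * (1 + 2 * P) ≤ b := by
      rw [← le_div_iff₀ (by positivity)]; exact min_le_right _ _
    have h3 : 1 + u ^ 2 + v ^ 2 ≤ (1 + 2 * P) + 2 * ((u - p.1) ^ 2 + (v - p.2) ^ 2) := by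
      rw [hP]; nlinarith [sq_nonneg (u - 2 * p.1), sq_nonneg (v - 2 * p.2)]
    have h4 := mul_le_mul_of_nonneg_left h3 hc₂0.le
    have h5 : 0 ≤ (u - p.1) ^ 2 + (v - p.2) ^ 2 := by positivity
    nlinarith
  set N : ℝ := 1 + u ^ 2 + v ^ 2 with hN
  have hN1 : 1 ≤ N := by rw [hN]; nlinarith [sq_nonneg u, sq_nonneg v]
  have hA0 : 0 < u ^ 2 + (v ^ 2 + a) := by positivity
  have hB0 : 0 < (u - p.1) ^ 2 + ((v - p.2) ^ 2 + b) := by positivity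
  have hsN : 1 ≤ √N := Real.one_le_sqrt.2 hN1
  have hu : |u| ≤ √N := Real.abs_le_sqrt (by rw [hN]; nlinarith [sq_nonneg v])
  have hv : |v| ≤ √N := Real.abs_le_sqrt (by rw [hN]; nlinarith [sq_nonneg u])
  have hnum : |((u - p.1) ^ 2 + ((v - p.2) ^ 2 + b)) - (u ^ 2 + (v ^ 2 + a))| ≤ K * √N := by
    have e : ((u - p.1) ^ 2 + ((v - p.2) ^ 2 + b)) - (u ^ 2 + (v ^ 2 + a))
        = -(2 * (u * p.1)) - 2 * (v * p.2) + (P + b - a) := by rw [hP]; ring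
    rw [e]
    have a1 : |u * p.1| ≤ √N * |p.1| := by rw [abs_mul]; gcongr
    have a2 : |v * p.2| ≤ √N * |p.2| := by rw [abs_mul]; gcongr
    have a3 : P + b + a ≤ (P + b + a) * √N := le_mul_of_one_le_right (by positivity) hsN
    rw [abs_le] at a1 a2 ⊢
    constructor <;> rw [hK] <;> nlinarith
  have hfin : √N / N ^ 2 ≤ (1 / (u ^ 2 + 1)) ^ (3 / 4 : ℝ) * (1 / (v ^ 2 + 1)) ^ (3 / 4 : ℝ) := by
    rw [← Real.mul_rpow (by positivity) (by positivity)]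
    have e1 : √N / N ^ 2 = (1 / N ^ 2) ^ (3 / 4 : ℝ) := by
      rw [Real.div_rpow (by norm_num) (by positivity), Real.one_rpow, Real.sqrt_eq_rpow,
        ← Real.rpow_natCast, ← Real.rpow_mul (by positivity), ← Real.rpow_sub (by positivity),
        one_div (N ^ _), ← Real.rpow_neg (by positivity)]
      norm_num
    rw [e1]
    gcongr
    rw [one_div_mul_one_div]
    gcongr
    rw [hN]
    nlinarith [sq_nonneg u, sq_nonneg v, mul_nonneg (sq_nonneg u) (sq_nonneg v)]
  rw [Real.norm_eq_abs, div_sub_div _ _ hA0.ne' hB0.ne', one_mul, mul_one, abs_div,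
    abs_of_pos (mul_pos hA0 hB0)]
  calc _ ≤ K * √N / ((c₁ * N) * (c₂ * N)) := by gcongr
    _ = K / (c₁ * c₂) * (√N / N ^ 2) := by field_simp
    _ ≤ _ := by
      have : 0 ≤ K := by positivity
      gcongr

/-- Two-dimensional lattice sums of differences of Lorentzians. -/
lemma tsum_lorentzian_diff {a b : ℝ} (ha : 0 < a) (hb : 0 < b) (p : ℝ × ℝ) :
    |∑' z : ℤ × ℤ, (1 / ((z.1 : ℝ) ^ 2 + ((z.2 : ℝ) ^ 2 + a)) -
      1 / (((z.1 : ℝ) - p.1) ^ 2 + ((z.2 - p.2) ^ 2 + b))) - π * Real.log (b / a)|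
      ≤ 24 * (1 / √a + 1 / a + 1 / √b + 1 / b) := by
  have hs := summable_lorentzian_diff ha hb p
  set S : ℤ → ℝ := fun x => ∑' y : ℤ, (1 / ((x : ℝ) ^ 2 + ((y : ℝ) ^ 2 + a)) -
      1 / (((x : ℝ) - p.1) ^ 2 + ((y - p.2) ^ 2 + b))) with hS
  have hS1 : Summable S := hs.prod
  rw [hs.tsum_prod]
  set φa : ℤ → ℝ := fun x => 1 / √(((x : ℝ) - 0) ^ 2 + a) with hφa
  set φb : ℤ → ℝ := fun x => 1 / √(((x : ℝ) - p.1) ^ 2 + b) with hφb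
  set r : ℤ → ℝ := fun x => S x - π * (φa x - φb x) with hr
  have hrb : ∀ x, |r x| ≤ 3 * (1 / (((x : ℝ) - 0) ^ 2 + a)) + 3 * (1 / (((x : ℝ) - p.1) ^ 2 + b)) := by
    intro x
    have h1 := tsum_lorentzian (show 0 < ((x : ℝ) - 0) ^ 2 + a by positivity) 0
    have h2 := tsum_lorentzian (show 0 < ((x : ℝ) - p.1) ^ 2 + b by positivity) p.2
    have h3 : S x = ∑' y : ℤ, 1 / (((y : ℝ) - 0) ^ 2 + (((x : ℝ) - 0) ^ 2 + a)) -
        ∑' y : ℤ, 1 / (((y : ℝ) - p.2) ^ 2 + (((x : ℝ) - p.1) ^ 2 + b)) := by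
      rw [← h1.1.tsum_sub h2.1, hS]
      refine tsum_congr fun y => ?_
      congr 2 <;> ring
    have a1 := abs_le.1 h1.2
    have a2 := abs_le.1 h2.2
    simp only [hr, hφa, hφb]
    rw [h3, abs_le]
    constructor <;> simp only [mul_sub, mul_one_div] <;> linarith [a1.1, a1.2, a2.1, a2.2]
  have sa := (tsum_lorentzian ha 0).1
  have sb := (tsum_lorentzian hb p.1).1
  have ta := tsum_lorentzian_le ha 0
  have tb := tsum_lorentzian_le hb p.1
  have sbd := (sa.mul_left 3).add (sb.mul_left 3)
  have hrs : Summable r := Summable.of_norm_bounded sbd hrb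
  have hrt : |∑' x, r x| ≤ 3 * (π / √a + 3 / a) + 3 * (π / √b + 3 / b) := by
    refine (tsum_of_norm_bounded (f := r) sbd.hasSum hrb).trans ?_
    rw [(sa.mul_left 3).tsum_add (sb.mul_left 3), tsum_mul_left, tsum_mul_left]
    linarith
  set Ψ : ℝ → ℝ := fun x => arsinh (x / √a) - arsinh ((x - p.1) / √b) with hΨ
  obtain ⟨ua, va⟩ := summable_sqrt_cell_error ha 0
  obtain ⟨ub, vb⟩ := summable_sqrt_cell_error hb p.1
  set ea : ℤ → ℝ := fun z => 1 / √((z - 0) ^ 2 + a) -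
      (arsinh ((z - 0 + 1) / √a) - arsinh ((z - 0) / √a)) with hea
  set eb : ℤ → ℝ := fun z => 1 / √((z - p.1) ^ 2 + b) -
      (arsinh ((z - p.1 + 1) / √b) - arsinh ((z - p.1) / √b)) with heb
  have hEA : |∑' z, ea z| ≤ 3 / √a := (norm_tsum_le_tsum_norm (f := ea) ua).trans va
  have hEB : |∑' z, eb z| ≤ 3 / √b := (norm_tsum_le_tsum_norm (f := eb) ub).trans vb
  have hdecomp : ∀ x : ℤ, S x = r x + π * (ea x - eb x) + π * (Ψ (x + 1) - Ψ x) := by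
    intro x
    simp only [hr, hφa, hφb, hea, heb, hΨ, sub_zero]
    rw [show (x : ℝ) + 1 - p.1 = x - p.1 + 1 by ring]
    ring
  have sE : Summable (fun x => ea x - eb x) := ua.of_abs.sub ub.of_abs
  have sΨ : Summable (fun x : ℤ => Ψ (x + 1) - Ψ x) := by
    have h := ((hS1.sub hrs).sub (sE.mul_left π)).mul_left (1 / π)
    refine h.congr fun x => ?_
    rw [hdecomp x]
    field_simp
    ring
  have l1 : Filter.Tendsto Ψ Filter.atTop (nhds (Real.log (b / a) / 2)) :=
    tendsto_arsinh_sub_arsinh ha hb p.1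
  have l2 : Filter.Tendsto Ψ Filter.atBot (nhds (-(Real.log (b / a) / 2))) := by
    have h := ((tendsto_arsinh_sub_arsinh ha hb (-p.1)).comp
      Filter.tendsto_neg_atBot_atTop).neg
    refine h.congr fun x => ?_
    simp only [Function.comp, hΨ]
    rw [show -x - -p.1 = -(x - p.1) by ring, neg_div, neg_div, arsinh_neg, arsinh_neg]
    ring
  have tΨ := tsum_int_telescope sΨ l1 l2
  have hsum : ∑' x, S x - π * Real.log (b / a) =
      ∑' x, r x + π * (∑' x, ea x - ∑' x, eb x) := by
    rw [tsum_congr hdecomp, (hrs.add (sE.mul_left π)).tsum_add (sΨ.mul_left π),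
      hrs.tsum_add (sE.mul_left π), tsum_mul_left, tsum_mul_left, tΨ,
      ua.of_abs.tsum_sub ub.of_abs]
    ring
  change |∑' x, S x - π * Real.log (b / a)| ≤ _
  rw [hsum]
  have hπ := Real.pi_le_four
  have hπ0 := Real.pi_pos
  have b1 : |π * (∑' x, ea x - ∑' x, eb x)| ≤ 4 * (3 / √a + 3 / √b) := by
    rw [abs_mul, abs_of_pos hπ0]
    gcongr
    exact (abs_sub _ _).trans (add_le_add hEA hEB)
  have c1 : π / √a ≤ 4 * (1 / √a) := by rw [mul_one_div]; gcongr
  have c2 : π / √b ≤ 4 * (1 / √b) := by rw [mul_one_div]; gcongr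
  have d1 : 0 < 1 / a := by positivity
  have d2 : 0 < 1 / b := by positivity
  refine (abs_add_le _ _).trans ((add_le_add hrt b1).trans ?_)
  rw [show (3 : ℝ) / √a = 3 * (1 / √a) by ring, show (3 : ℝ) / √b = 3 * (1 / √b) by ring,
    show (3 : ℝ) / a = 3 * (1 / a) by ring, show (3 : ℝ) / b = 3 * (1 / b) by ring]
  linarith

lemma sum_range_decay_le {R : ℝ} (hR : 0 < R) (N : ℕ) :
    ∑ j ∈ Finset.range N, R ^ 2 / ((R + (j + 1)) ^ 2 * √(R * (j + 1))) ≤ 2 := by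
  set u : ℕ → ℝ := fun j => √((j : ℝ) / (R + j)) with hu
  have hstep : ∀ j : ℕ, R ^ 2 / ((R + (j + 1)) ^ 2 * √(R * (j + 1))) ≤ 2 * (u (j + 1) - u j) := by
    intro j
    have hx : (0 : ℝ) < (j : ℝ) + 1 := by positivity
    have hj : (0 : ℝ) ≤ j := by positivity
    have e1 : u (j + 1) ^ 2 = (j + 1) / (R + (j + 1)) := by
      simp only [hu]; push_cast; rw [Real.sq_sqrt (by positivity)]
    have e2 : u j ^ 2 = j / (R + j) := by simp only [hu]; rw [Real.sq_sqrt (by positivity)]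
    have p1 : 0 < u (j + 1) := by simp only [hu]; positivity
    have p0 : 0 ≤ u j := Real.sqrt_nonneg _
    have d : R / (R + (j + 1)) ^ 2 ≤ u (j + 1) ^ 2 - u j ^ 2 := by
      rw [e1, e2, div_sub_div _ _ (by positivity) (by positivity),
        div_le_div_iff₀ (by positivity) (by positivity)]
      have : ((j : ℝ) + 1) * (R + j) - (R + (j + 1)) * j = R := by ring
      rw [this]
      have : (R + (j + 1)) * (R + j) ≤ (R + (j + 1)) ^ 2 := by nlinarith
      exact mul_le_mul_of_nonneg_left this hR.le
    have hmono : u j ≤ u (j + 1) := by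
      have : 0 ≤ R / (R + (j + 1)) ^ 2 := by positivity
      exact (sq_le_sq₀ p0 p1.le).1 (by linarith)
    have d2 : R / (R + (j + 1)) ^ 2 ≤ (u (j + 1) - u j) * (2 * u (j + 1)) := by nlinarith
    have d3 : R / ((R + (j + 1)) ^ 2 * u (j + 1)) ≤ 2 * (u (j + 1) - u j) := by
      rw [← div_div, div_le_iff₀ p1]; linarith
    refine le_trans ?_ d3
    have e3 : R * u (j + 1) ≤ √(R * (j + 1)) := by
      refine Real.le_sqrt_of_sq_le ?_
      rw [mul_pow, e1, ← mul_div_assoc, div_le_iff₀ (by positivity)]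
      nlinarith [mul_pos hR hx]
    have hs : 0 < √(R * (j + 1)) := by positivity
    rw [div_le_div_iff₀ (by positivity) (by positivity)]
    have h2 := mul_le_mul_of_nonneg_left e3 (show 0 ≤ R * (R + (j + 1)) ^ 2 by positivity)
    nlinarith
  refine (Finset.sum_le_sum fun j _ => hstep j).trans ?_
  rw [← Finset.mul_sum, Finset.sum_range_sub]
  have : u N ≤ 1 := by
    rw [hu]
    refine Real.sqrt_le_one.2 ?_
    refine div_le_one_of_le₀ (by linarith) (by positivity)
  have h0 : u 0 = 0 := by simp [hu]
  linarith

/-- Sums over the lattice points outside a disc lying in one quarter of the plane, reorganized by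
the distance to the disc along the second coordinate. -/
lemma sum_quarter_le {μ ε : ℝ} (hμ : 1 ≤ μ) (hε : 0 < ε) (s : ℝ) (S : Finset (ℤ × ℤ))
    (hS : ∀ z ∈ S, 0 < z.2 ∧ |z.1| ≤ z.2 ∧ μ < (z.1 : ℝ) ^ 2 + (z.2 : ℝ) ^ 2) :
    ∑ z ∈ S, μ / (((z.1 : ℝ) ^ 2 + (z.2 : ℝ) ^ 2) *
      ((z.1 : ℝ) ^ 2 + (z.2 : ℝ) ^ 2 - μ + ε + (z.1 - s) ^ 2)) ≤ 140 * (1 + 1 / ε) := by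
  set R : ℝ := √μ with hR
  have hR1 : 1 ≤ R := Real.one_le_sqrt.2 hμ
  have hR2 : R ^ 2 = μ := Real.sq_sqrt (by linarith)
  set ι : ℤ × ℤ → ℤ × ℕ := fun z => (z.1, ⌊(z.2 : ℝ) - √(μ - (z.1 : ℝ) ^ 2)⌋₊) with hι
  set v : ℤ × ℕ → ℝ := fun w => 4 * (R ^ 2 / (R + w.2) ^ 2) *
    (1 / (((w.1 : ℝ) - s) ^ 2 + (w.2 * R / 2 + ε))) with hv
  have hv0 : ∀ w, 0 ≤ v w := fun w => by simp only [hv]; positivity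
  have hlt : ∀ z ∈ S, √(μ - (z.1 : ℝ) ^ 2) < z.2 := by
    intro z hz
    obtain ⟨h1, -, h3⟩ := hS z hz
    rw [Real.sqrt_lt' (by exact_mod_cast h1)]
    linarith
  have hinj : Set.InjOn ι S := by
    intro z hz w hw h
    simp only [hι, Prod.mk.injEq] at h
    obtain ⟨h1, h2⟩ := h
    have a1 := hlt z hz
    have a2 := hlt w hw
    rw [h1] at a1 h2
    have b1 := Nat.floor_le (sub_pos.2 a1).le
    have b2 := Nat.floor_le (sub_pos.2 a2).le
    have c1 := Nat.lt_floor_add_one ((z.2 : ℝ) - √(μ - (w.1 : ℝ) ^ 2))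
    have c2 := Nat.lt_floor_add_one ((w.2 : ℝ) - √(μ - (w.1 : ℝ) ^ 2))
    rw [h2] at b1 c1
    have e1 : (z.2 : ℝ) < w.2 + 1 := by linarith
    have e2 : (w.2 : ℝ) < z.2 + 1 := by linarith
    refine Prod.ext h1 ?_
    have e1' : z.2 < w.2 + 1 := by exact_mod_cast e1
    have e2' : w.2 < z.2 + 1 := by exact_mod_cast e2
    omega
  have hpt : ∀ z ∈ S, μ / (((z.1 : ℝ) ^ 2 + (z.2 : ℝ) ^ 2) *
      ((z.1 : ℝ) ^ 2 + (z.2 : ℝ) ^ 2 - μ + ε + (z.1 - s) ^ 2)) ≤ v (ι z) := by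
    intro z hz
    obtain ⟨h1, h2, h3⟩ := hS z hz
    have a1 := hlt z hz
    have b1 := Nat.floor_le (sub_pos.2 a1).le
    simp only [hv, hι]
    set j : ℝ := (⌊(z.2 : ℝ) - √(μ - (z.1 : ℝ) ^ 2)⌋₊ : ℝ) with hj
    have hj0 : 0 ≤ j := by positivity
    set y0 : ℝ := √(μ - (z.1 : ℝ) ^ 2) with hy0
    have hy00 : 0 ≤ y0 := Real.sqrt_nonneg _
    have hy0sq : μ - (z.1 : ℝ) ^ 2 ≤ y0 ^ 2 := by
      rcases le_total 0 (μ - (z.1 : ℝ) ^ 2) with h | h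
      · rw [hy0, Real.sq_sqrt h]
      · exact h.trans (sq_nonneg _)
    have hxy : |(z.1 : ℝ)| ≤ z.2 := by exact_mod_cast h2
    have hy : (0 : ℝ) < z.2 := by exact_mod_cast h1
    set x : ℝ := (z.1 : ℝ)
    set y : ℝ := (z.2 : ℝ)
    have hxy2 : x ^ 2 ≤ y ^ 2 := sq_le_sq' (by linarith [(abs_le.1 hxy).1]) (abs_le.1 hxy).2
    have hyR : R / 2 ≤ y := by
      refine (abs_le_of_sq_le_sq' ?_ hy.le).2
      nlinarith
    have hq : j * R / 2 ≤ x ^ 2 + y ^ 2 - μ := by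
      have c1 : j * (R / 2) ≤ (y - y0) * (y + y0) := by
        refine mul_le_mul b1 (by linarith) (by linarith) (by linarith)
      nlinarith
    have hp : (R + j) ^ 2 / 4 ≤ x ^ 2 + y ^ 2 := by
      have : j ≤ y := by linarith
      nlinarith [sq_nonneg (R - j), mul_self_le_mul_self hj0 this]
    have hp0 : 0 < (R + j) ^ 2 / 4 := by positivity
    have hq0 : 0 < (x - s) ^ 2 + (j * R / 2 + ε) := by positivity
    calc _ ≤ μ / ((R + j) ^ 2 / 4 * ((x - s) ^ 2 + (j * R / 2 + ε))) := by
          have hq1 : (x - s) ^ 2 + (j * R / 2 + ε) ≤ x ^ 2 + y ^ 2 - μ + ε + (x - s) ^ 2 := by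
            linarith
          exact div_le_div_of_nonneg_left (by linarith) (mul_pos hp0 hq0)
            (mul_le_mul hp hq1 hq0.le (by positivity))
      _ = _ := by rw [hR2]; field_simp
  have hcol : ∀ (X : Finset ℤ) (j : ℕ), ∑ x ∈ X, v (x, j) ≤
      4 * (R ^ 2 / (R + j) ^ 2) * (π / √(j * R / 2 + ε) + 3 / (j * R / 2 + ε)) := by
    intro X j
    have hβ : 0 < (j : ℝ) * R / 2 + ε := by positivity
    simp only [hv]
    rw [← Finset.mul_sum]
    gcongr
    exact ((tsum_lorentzian hβ s).1.sum_le_tsum X (fun i _ => by positivity)).trans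
      (tsum_lorentzian_le hβ s)
  have hcol0 : ∀ X : Finset ℤ, ∑ x ∈ X, v (x, 0) ≤ 28 * (1 + 1 / ε) := by
    intro X
    refine (hcol X 0).trans ?_
    have h1 : R ^ 2 / (R + ((0 : ℕ) : ℝ)) ^ 2 = 1 := by
      rw [Nat.cast_zero, add_zero, div_self (by positivity)]
    rw [h1]
    simp only [Nat.cast_zero, zero_mul, zero_div, zero_add]
    have hse : 0 < √ε := Real.sqrt_pos.2 hε
    have h2 : 1 / √ε ≤ 1 + 1 / ε := by
      have : 1 / ε = (1 / √ε) ^ 2 := by rw [div_pow, Real.sq_sqrt hε.le, one_pow]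
      rw [this]
      nlinarith [sq_nonneg (1 / √ε - 1)]
    have h3 : π / √ε ≤ 4 * (1 / √ε) := by
      rw [mul_one_div]; have := Real.pi_le_four; gcongr
    have h4 : 3 / ε = 3 * (1 / ε) := by ring
    linarith
  have hcol1 : ∀ (X : Finset ℤ) (j : ℕ), ∑ x ∈ X, v (x, j + 1) ≤
      56 * (R ^ 2 / ((R + (j + 1)) ^ 2 * √(R * (j + 1)))) := by
    intro X j
    refine (hcol X (j + 1)).trans ?_
    push_cast
    set B : ℝ := R * (j + 1) with hB
    have hj0 : (0 : ℝ) ≤ j := by positivity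
    have hB1 : 1 ≤ B := by rw [hB]; nlinarith
    have hsB : 1 ≤ √B := Real.one_le_sqrt.2 hB1
    have hBs : √B ^ 2 = B := Real.sq_sqrt (by linarith)
    have e : ((j : ℝ) + 1) * R / 2 + ε = B / 2 + ε := by rw [hB]; ring
    rw [e]
    have h1 : √B / 2 ≤ √(B / 2 + ε) := by
      refine Real.le_sqrt_of_sq_le ?_
      rw [div_pow, hBs]; linarith
    have h2 : √B / 2 ≤ B / 2 + ε := by nlinarith
    have hb : π / √(B / 2 + ε) + 3 / (B / 2 + ε) ≤ 14 * (1 / √B) := by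
      have := Real.pi_le_four
      calc _ ≤ 4 / (√B / 2) + 3 / (√B / 2) := by gcongr
        _ = _ := by field_simp; norm_num
    calc _ ≤ 4 * (R ^ 2 / (R + (j + 1)) ^ 2) * (14 * (1 / √B)) := by gcongr
      _ = _ := by field_simp; norm_num
  set T := S.image ι with hT
  obtain ⟨N, hN⟩ := Finset.exists_nat_subset_range (T.image Prod.snd)
  have hsub : T ⊆ (T.image Prod.fst) ×ˢ (Finset.range (N + 1)) := by
    intro w hw
    rw [Finset.mem_product]
    refine ⟨Finset.mem_image_of_mem _ hw, ?_⟩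
    have := Finset.mem_range.1 (hN (Finset.mem_image_of_mem Prod.snd hw))
    exact Finset.mem_range.2 (by omega)
  calc _ ≤ ∑ z ∈ S, v (ι z) := Finset.sum_le_sum hpt
    _ = ∑ w ∈ T, v w := by rw [hT, Finset.sum_image hinj]
    _ ≤ ∑ w ∈ (T.image Prod.fst) ×ˢ (Finset.range (N + 1)), v w :=
        Finset.sum_le_sum_of_subset_of_nonneg hsub (fun w _ _ => hv0 w)
    _ = ∑ j ∈ Finset.range N, ∑ x ∈ T.image Prod.fst, v (x, j + 1) +
          ∑ x ∈ T.image Prod.fst, v (x, 0) := by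
        rw [Finset.sum_product_right, Finset.sum_range_succ']
    _ ≤ ∑ j ∈ Finset.range N, 56 * (R ^ 2 / ((R + (j + 1)) ^ 2 * √(R * (j + 1)))) +
          28 * (1 + 1 / ε) :=
        add_le_add (Finset.sum_le_sum fun j _ => hcol1 _ j) (hcol0 _)
    _ ≤ 56 * 2 + 28 * (1 + 1 / ε) := by
        rw [← Finset.mul_sum]
        have := sum_range_decay_le (by linarith : 0 < R) N
        gcongr
    _ ≤ _ := by
        have : 0 < 1 / ε := by positivity
        linarith

lemma sum_sector_le {μ ε : ℝ} (hμ : 1 ≤ μ) (hε : 0 < ε) (q : ℝ × ℝ) (s : ℝ)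
    (S : Finset (ℤ × ℤ)) (hS : ∀ z ∈ S, μ < (z.1 : ℝ) ^ 2 + (z.2 : ℝ) ^ 2)
    (ι : ℤ × ℤ → ℤ × ℤ) (hinj : Function.Injective ι)
    (hι : ∀ z, ((ι z).1 : ℝ) ^ 2 + ((ι z).2 : ℝ) ^ 2 = (z.1 : ℝ) ^ 2 + (z.2 : ℝ) ^ 2)
    (hs : ∀ z, ((ι z).1 - s) ^ 2 ≤ ((z.1 : ℝ) - q.1) ^ 2 + (z.2 - q.2) ^ 2) :
    ∑ z ∈ S, (if 0 < (ι z).2 ∧ |(ι z).1| ≤ (ι z).2 then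
      μ / (((z.1 : ℝ) ^ 2 + (z.2 : ℝ) ^ 2) * ((z.1 : ℝ) ^ 2 + (z.2 : ℝ) ^ 2 - μ + ε +
        (((z.1 : ℝ) - q.1) ^ 2 + (z.2 - q.2) ^ 2))) else 0) ≤ 140 * (1 + 1 / ε) := by
  rw [← Finset.sum_filter]
  set S' := S.filter fun z => 0 < (ι z).2 ∧ |(ι z).1| ≤ (ι z).2 with hS'
  refine le_trans ?_ (sum_quarter_le hμ hε s (S'.image ι) ?_)
  · rw [Finset.sum_image hinj.injOn]
    refine Finset.sum_le_sum fun z hz => ?_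
    have h1 := hS z (Finset.mem_filter.1 hz).1
    rw [hι z]
    have h2 := hs z
    have h3 : 0 ≤ ((ι z).1 - s) ^ 2 := sq_nonneg _
    have h4 : 0 < ((z.1 : ℝ) ^ 2 + (z.2 : ℝ) ^ 2 - μ + ε + ((ι z).1 - s) ^ 2) := by linarith
    have h5 : 0 < (z.1 : ℝ) ^ 2 + (z.2 : ℝ) ^ 2 := by linarith
    have h6 := mul_pos h5 h4
    gcongr
  · intro w hw
    obtain ⟨z, hz, rfl⟩ := Finset.mem_image.1 hw
    obtain ⟨h1, h2, h3⟩ := Finset.mem_filter.1 hz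
    exact ⟨h2, h3, by rw [hι]; exact hS z h1⟩

/-- The lattice sum outside the Fermi disc. -/
lemma sum_outside_le {μ ε : ℝ} (hμ : 1 ≤ μ) (hε : 0 < ε) (q : ℝ × ℝ)
    (S : Finset (ℤ × ℤ)) (hS : ∀ z ∈ S, μ < (z.1 : ℝ) ^ 2 + (z.2 : ℝ) ^ 2) :
    ∑ z ∈ S, μ / (((z.1 : ℝ) ^ 2 + (z.2 : ℝ) ^ 2) * ((z.1 : ℝ) ^ 2 + (z.2 : ℝ) ^ 2 - μ + ε +
        (((z.1 : ℝ) - q.1) ^ 2 + (z.2 - q.2) ^ 2))) ≤ 560 * (1 + 1 / ε) := by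
  have h1 := sum_sector_le hμ hε q q.1 S hS id Function.injective_id (fun z => rfl)
    (fun z => by simp only [id]; nlinarith [sq_nonneg ((z.2 : ℝ) - q.2)])
  have h2 := sum_sector_le hμ hε q q.1 S hS (fun z => (z.1, -z.2))
    (fun z w h => by simpa [Prod.ext_iff] using h) (fun z => by push_cast; ring)
    (fun z => by dsimp only; nlinarith [sq_nonneg ((z.2 : ℝ) - q.2)])
  have h3 := sum_sector_le hμ hε q q.2 S hS (fun z => (z.2, z.1))
    (fun z w h => by simpa [Prod.ext_iff, and_comm] using h) (fun z => by push_cast; ring)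
    (fun z => by dsimp only; nlinarith [sq_nonneg ((z.1 : ℝ) - q.1)])
  have h4 := sum_sector_le hμ hε q q.2 S hS (fun z => (z.2, -z.1))
    (fun z w h => by simpa [Prod.ext_iff, and_comm] using h) (fun z => by push_cast; ring)
    (fun z => by dsimp only; nlinarith [sq_nonneg ((z.1 : ℝ) - q.1)])
  have h5 := add_le_add (add_le_add h1 h2) (add_le_add h3 h4)
  rw [← Finset.sum_add_distrib, ← Finset.sum_add_distrib, ← Finset.sum_add_distrib] at h5
  refine le_trans (Finset.sum_le_sum fun z hz => ?_) (h5.trans (by linarith))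
  have hz' := hS z hz
  set F : ℝ := μ / (((z.1 : ℝ) ^ 2 + (z.2 : ℝ) ^ 2) * ((z.1 : ℝ) ^ 2 + (z.2 : ℝ) ^ 2 - μ + ε +
        (((z.1 : ℝ) - q.1) ^ 2 + (z.2 - q.2) ^ 2))) with hF
  have hF0 : 0 ≤ F := by
    have : 0 < (z.1 : ℝ) ^ 2 + (z.2 : ℝ) ^ 2 - μ + ε := by linarith
    positivity
  have hne : z.1 ≠ 0 ∨ z.2 ≠ 0 := by
    by_contra! h
    rw [h.1, h.2] at hz'
    norm_num at hz'
    linarith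
  have hcases : (0 < z.2 ∧ |z.1| ≤ z.2) ∨ (0 < -z.2 ∧ |z.1| ≤ -z.2) ∨
      (0 < z.1 ∧ |z.2| ≤ z.1) ∨ (0 < -z.1 ∧ |z.2| ≤ -z.1) := by
    simp only [abs_le]
    omega
  have hite : ∀ (P : Prop) [Decidable P], 0 ≤ (if P then F else 0) := by
    intro P _; split_ifs <;> linarith
  have i1 := hite (0 < z.2 ∧ |z.1| ≤ z.2)
  have i2 := hite (0 < -z.2 ∧ |z.1| ≤ -z.2)
  have i3 := hite (0 < z.1 ∧ |z.2| ≤ z.1)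
  have i4 := hite (0 < -z.1 ∧ |z.2| ≤ -z.1)
  simp only [id]
  rcases hcases with h | h | h | h
  · rw [if_pos h] at i1 ⊢; linarith
  · rw [if_pos h] at i2 ⊢; linarith
  · rw [if_pos h] at i3 ⊢; linarith
  · rw [if_pos h] at i4 ⊢; linarith

lemma card_inside_le {μ : ℝ} (hμ : 1 ≤ μ) (S : Finset (ℤ × ℤ))
    (hS : ∀ z ∈ S, (z.1 : ℝ) ^ 2 + (z.2 : ℝ) ^ 2 ≤ μ) : (S.card : ℝ) ≤ 9 * μ := by
  set n : ℤ := ⌊√μ⌋ with hn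
  have hs1 : 1 ≤ √μ := Real.one_le_sqrt.2 hμ
  have hn0 : 0 ≤ n := Int.floor_nonneg.2 (by linarith)
  have hnle : (n : ℝ) ≤ √μ := Int.floor_le _
  have hbd : ∀ k : ℤ, (k : ℝ) ^ 2 ≤ μ → k ∈ Finset.Icc (-n) n := by
    intro k hk
    have h := abs_le.1 (Real.abs_le_sqrt hk)
    have h1 : k ≤ n := Int.le_floor.2 h.2
    have h2 : -k ≤ n := Int.le_floor.2 (by push_cast; linarith [h.1])
    exact Finset.mem_Icc.2 ⟨by omega, h1⟩
  have hsub : S ⊆ Finset.Icc (-n) n ×ˢ Finset.Icc (-n) n := by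
    intro z hz
    have := hS z hz
    exact Finset.mem_product.2 ⟨hbd _ (by nlinarith [sq_nonneg (z.2 : ℝ)]),
      hbd _ (by nlinarith [sq_nonneg (z.1 : ℝ)])⟩
  have hc := Finset.card_le_card hsub
  rw [Finset.card_product, Int.card_Icc] at hc
  have hcast : ((n + 1 - -n).toNat : ℝ) = 2 * n + 1 := by
    have : ((n + 1 - -n).toNat : ℤ) = 2 * n + 1 := by omega
    exact_mod_cast this
  have hc' : (S.card : ℝ) ≤ (2 * n + 1) * (2 * n + 1) := by
    rw [← hcast]; exact_mod_cast hc
  have hn0' : (0 : ℝ) ≤ n := by exact_mod_cast hn0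
  have h3 : (2 * (n : ℝ) + 1) ≤ 3 * √μ := by linarith
  calc (S.card : ℝ) ≤ (2 * n + 1) * (2 * n + 1) := hc'
    _ ≤ (3 * √μ) * (3 * √μ) := by gcongr
    _ = 9 * μ := by
      have := Real.mul_self_sqrt (show 0 ≤ μ by linarith)
      linear_combination 9 * this

lemma one_div_sqrt_le {x : ℝ} (hx : 0 < x) : 1 / √x ≤ 1 + 1 / x := by
  have : 1 / x = (1 / √x) ^ 2 := by rw [div_pow, Real.sq_sqrt hx.le, one_pow]
  rw [this]
  nlinarith [sq_nonneg (1 / √x - 1)]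

/-- Removing the Fermi disc and adding `(1 + 1 / M) * μ` to the energy denominator changes the
lattice sum by a bounded amount. -/
lemma tsum_cutoff_error {M μ τ : ℝ} (hM : 1 < M) (hμ : 1 ≤ μ) (hτ : 0 < μ + τ) (q : ℝ × ℝ) :
    Summable (fun z : ℤ × ℤ =>
      1 / ((1 / M) * ((q.1 - z.1) ^ 2 + (q.2 - z.2) ^ 2) + ((z.1 : ℝ) ^ 2 + (z.2 : ℝ) ^ 2) + τ
        + (1 + 1 / M) * μ) - chi μ ((z.1 : ℝ) ^ 2 + (z.2 : ℝ) ^ 2) /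
      ((1 / M) * ((q.1 - z.1) ^ 2 + (q.2 - z.2) ^ 2) + ((z.1 : ℝ) ^ 2 + (z.2 : ℝ) ^ 2) + τ)) ∧
    |∑' z : ℤ × ℤ,
      (1 / ((1 / M) * ((q.1 - z.1) ^ 2 + (q.2 - z.2) ^ 2) + ((z.1 : ℝ) ^ 2 + (z.2 : ℝ) ^ 2) + τ
        + (1 + 1 / M) * μ) - chi μ ((z.1 : ℝ) ^ 2 + (z.2 : ℝ) ^ 2) /
      ((1 / M) * ((q.1 - z.1) ^ 2 + (q.2 - z.2) ^ 2) + ((z.1 : ℝ) ^ 2 + (z.2 : ℝ) ^ 2) + τ))|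
      ≤ 1129 * M * (1 + 1 / (μ + τ)) := by
  have hM0 : 0 < M := by linarith
  set g : ℤ × ℤ → ℝ := fun z =>
      1 / ((1 / M) * ((q.1 - z.1) ^ 2 + (q.2 - z.2) ^ 2) + ((z.1 : ℝ) ^ 2 + (z.2 : ℝ) ^ 2) + τ
        + (1 + 1 / M) * μ) - chi μ ((z.1 : ℝ) ^ 2 + (z.2 : ℝ) ^ 2) /
      ((1 / M) * ((q.1 - z.1) ^ 2 + (q.2 - z.2) ^ 2) + ((z.1 : ℝ) ^ 2 + (z.2 : ℝ) ^ 2) + τ) with hg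
  set c : ℝ := 1 / M with hc
  have hc0 : 0 < c := by positivity
  have hc1 : c ≤ 1 := by rw [hc, div_le_one hM0]; linarith
  have hMc : M * c = 1 := by rw [hc]; field_simp
  set F : ℤ × ℤ → ℝ := fun z => μ / (((z.1 : ℝ) ^ 2 + (z.2 : ℝ) ^ 2) *
    ((z.1 : ℝ) ^ 2 + (z.2 : ℝ) ^ 2 - μ + (μ + τ) + (((z.1 : ℝ) - q.1) ^ 2 + (z.2 - q.2) ^ 2))) with hF
  have hin : ∀ z : ℤ × ℤ, (z.1 : ℝ) ^ 2 + (z.2 : ℝ) ^ 2 ≤ μ → |g z| ≤ M / μ := by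
    intro z hz
    have hchi : chi μ ((z.1 : ℝ) ^ 2 + (z.2 : ℝ) ^ 2) = 0 := by
      rw [chi, if_neg (not_lt.2 hz)]
    simp only [hg]
    rw [hchi, zero_div, sub_zero]
    have h1 : c * μ ≤ c * ((q.1 - z.1) ^ 2 + (q.2 - z.2) ^ 2) + ((z.1 : ℝ) ^ 2 + (z.2 : ℝ) ^ 2)
        + τ + (1 + c) * μ := by
      have : 0 ≤ c * ((q.1 - z.1) ^ 2 + (q.2 - z.2) ^ 2) := by positivity
      have : 0 ≤ (z.1 : ℝ) ^ 2 + (z.2 : ℝ) ^ 2 := by positivity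
      linarith
    have h2 : 0 < c * μ := by positivity
    rw [abs_of_nonneg (by have := h2.trans_le h1; positivity)]
    calc _ ≤ 1 / (c * μ) := by gcongr
      _ = M / μ := by rw [hc]; field_simp
  have hout : ∀ z : ℤ × ℤ, μ < (z.1 : ℝ) ^ 2 + (z.2 : ℝ) ^ 2 → |g z| ≤ 2 * M * F z := by
    intro z hz
    have hchi : chi μ ((z.1 : ℝ) ^ 2 + (z.2 : ℝ) ^ 2) = 1 := by rw [chi, if_pos hz]
    simp only [hg, hF]
    rw [hchi]
    have hd : ((z.1 : ℝ) - q.1) ^ 2 + (z.2 - q.2) ^ 2 = (q.1 - z.1) ^ 2 + (q.2 - z.2) ^ 2 := by ring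
    rw [hd]
    set n : ℝ := (z.1 : ℝ) ^ 2 + (z.2 : ℝ) ^ 2
    set d : ℝ := (q.1 - z.1) ^ 2 + (q.2 - z.2) ^ 2 with hd'
    have hd0 : 0 ≤ d := by positivity
    have hn0 : 0 < n := by linarith
    have hQ0 : 0 < n - μ + (μ + τ) + d := by linarith
    have hD : c * (n - μ + (μ + τ) + d) ≤ c * d + n + τ := by nlinarith
    have hD0 : 0 < c * d + n + τ := lt_of_lt_of_le (by positivity) hD
    have hDm : n ≤ c * d + n + τ + (1 + c) * μ := by
      have : 0 ≤ c * d := by positivity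
      have : 0 ≤ c * μ := by positivity
      linarith
    have hDm0 : 0 < c * d + n + τ + (1 + c) * μ := by linarith
    rw [div_sub_div _ _ hDm0.ne' hD0.ne', abs_div, abs_of_pos (mul_pos hDm0 hD0)]
    have hnum : |1 * (c * d + n + τ) - (c * d + n + τ + (1 + c) * μ) * 1| ≤ 2 * μ := by
      have h0 : 0 ≤ c * μ := by positivity
      rw [abs_le]; constructor <;> nlinarith
    calc _ ≤ 2 * μ / (n * (c * (n - μ + (μ + τ) + d))) := by gcongr
      _ = _ := by rw [hc]; field_simp
  have hfin : ∀ S : Finset (ℤ × ℤ), ∑ z ∈ S, |g z| ≤ 1129 * M * (1 + 1 / (μ + τ)) := by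
    intro S
    rw [← Finset.sum_filter_add_sum_filter_not S
      (fun z : ℤ × ℤ => (z.1 : ℝ) ^ 2 + (z.2 : ℝ) ^ 2 ≤ μ)]
    have h1 : ∑ z ∈ S with (z.1 : ℝ) ^ 2 + (z.2 : ℝ) ^ 2 ≤ μ, |g z| ≤ 9 * M := by
      refine (Finset.sum_le_card_nsmul _ _ _ fun z hz => hin z (Finset.mem_filter.1 hz).2).trans ?_
      rw [nsmul_eq_mul]
      calc _ ≤ 9 * μ * (M / μ) := by
            gcongr
            exact card_inside_le hμ _ fun z hz => (Finset.mem_filter.1 hz).2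
        _ = 9 * M := by field_simp
    have h2 : ∑ z ∈ S with ¬ ((z.1 : ℝ) ^ 2 + (z.2 : ℝ) ^ 2 ≤ μ), |g z| ≤
        2 * M * (560 * (1 + 1 / (μ + τ))) := by
      refine (Finset.sum_le_sum fun z hz =>
        hout z (not_le.1 (Finset.mem_filter.1 hz).2)).trans ?_
      rw [← Finset.mul_sum]
      gcongr
      exact sum_outside_le hμ hτ q _ fun z hz => not_le.1 (Finset.mem_filter.1 hz).2
    have h3 : 0 < M * (1 / (μ + τ)) := by positivity
    nlinarith
  have hsum : Summable (fun z => |g z|) := summable_of_sum_le (fun z => abs_nonneg _) hfin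
  exact ⟨hsum.of_abs, (norm_tsum_le_tsum_norm (f := g) hsum).trans
    (Real.tsum_le_of_sum_le (fun z => abs_nonneg _) hfin)⟩

/-- The estimate on the unit lattice `ℤ²`. -/
lemma tsum_unit_lattice {M E μ τ : ℝ} (hM : 1 < M) (hE : 1 / 40 ≤ E) (hμ : 1 ≤ μ)
    (hτ : 0 < μ + τ) (q : ℝ × ℝ) :
    |∑' z : ℤ × ℤ, (1 / ((1 + 1 / M) * ((z.1 : ℝ) ^ 2 + (z.2 : ℝ) ^ 2) + E) -
      chi μ ((z.1 : ℝ) ^ 2 + (z.2 : ℝ) ^ 2) /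
      ((1 / M) * ((q.1 - z.1) ^ 2 + (q.2 - z.2) ^ 2) + ((z.1 : ℝ) ^ 2 + (z.2 : ℝ) ^ 2) + τ))
      - π / (1 + 1 / M) *
        Real.log (((q.1 ^ 2 + q.2 ^ 2) / (M + 1) + (1 + 1 / M) * μ + τ) / E)| ≤
      6000 * M * (1 + 1 / (μ + τ)) := by
  have hM0 : 0 < M := by linarith
  obtain ⟨sg, tg⟩ := tsum_cutoff_error hM hμ hτ q
  set m : ℝ := 1 + 1 / M with hm
  have hm1 : 1 ≤ m := by
    have : 0 < 1 / M := by positivity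
    linarith
  have hm2 : m ≤ 2 := by
    have : 1 / M ≤ 1 := by rw [div_le_one hM0]; linarith
    linarith
  set A : ℝ := (q.1 ^ 2 + q.2 ^ 2) / (M + 1) + m * μ + τ with hA
  have hE0 : 0 < E := by linarith
  have hA1 : 1 / M ≤ A := by
    have h1 : 0 ≤ (q.1 ^ 2 + q.2 ^ 2) / (M + 1) := by positivity
    have h2 : 1 / M ≤ 1 / M * μ := le_mul_of_one_le_right (by positivity) hμ
    rw [hA, hm]
    linarith
  have hA0 : 0 < A := lt_of_lt_of_le (by positivity) hA1
  have ha : 0 < E / m := by positivity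
  have hb : 0 < A / m := by positivity
  set p : ℝ × ℝ := (q.1 / (M + 1), q.2 / (M + 1)) with hp
  have sl := summable_lorentzian_diff ha hb p
  have tl := tsum_lorentzian_diff ha hb p
  have ha1 : 1 / (E / m) ≤ 80 := by
    rw [one_div_div, div_le_iff₀ hE0]; linarith
  have hb1 : 1 / (A / m) ≤ 2 * M := by
    rw [one_div_div, div_le_iff₀ hA0]
    have : 1 ≤ M * A := by
      have := mul_le_mul_of_nonneg_left hA1 hM0.le
      rwa [mul_one_div_cancel hM0.ne'] at this
    nlinarith
  have ha2 := one_div_sqrt_le ha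
  have hb2 := one_div_sqrt_le hb
  have hlog : A / m / (E / m) = A / E := by field_simp
  rw [hlog] at tl
  have hterm : ∀ z : ℤ × ℤ, (1 / (m * ((z.1 : ℝ) ^ 2 + (z.2 : ℝ) ^ 2) + E) -
      chi μ ((z.1 : ℝ) ^ 2 + (z.2 : ℝ) ^ 2) /
      ((1 / M) * ((q.1 - z.1) ^ 2 + (q.2 - z.2) ^ 2) + ((z.1 : ℝ) ^ 2 + (z.2 : ℝ) ^ 2) + τ)) =
      1 / m * (1 / ((z.1 : ℝ) ^ 2 + ((z.2 : ℝ) ^ 2 + E / m)) -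
        1 / (((z.1 : ℝ) - p.1) ^ 2 + ((z.2 - p.2) ^ 2 + A / m))) +
      (1 / ((1 / M) * ((q.1 - z.1) ^ 2 + (q.2 - z.2) ^ 2) + ((z.1 : ℝ) ^ 2 + (z.2 : ℝ) ^ 2) + τ
        + m * μ) - chi μ ((z.1 : ℝ) ^ 2 + (z.2 : ℝ) ^ 2) /
      ((1 / M) * ((q.1 - z.1) ^ 2 + (q.2 - z.2) ^ 2) + ((z.1 : ℝ) ^ 2 + (z.2 : ℝ) ^ 2) + τ)) := by
    intro z
    have e1 : m * ((z.1 : ℝ) ^ 2 + (z.2 : ℝ) ^ 2) + E =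
        m * ((z.1 : ℝ) ^ 2 + ((z.2 : ℝ) ^ 2 + E / m)) := by field_simp; ring
    have e2 : (1 / M) * ((q.1 - z.1) ^ 2 + (q.2 - z.2) ^ 2) + ((z.1 : ℝ) ^ 2 + (z.2 : ℝ) ^ 2) + τ
        + m * μ = m * (((z.1 : ℝ) - p.1) ^ 2 + ((z.2 - p.2) ^ 2 + A / m)) := by
      have : m * (((z.1 : ℝ) - p.1) ^ 2 + ((z.2 - p.2) ^ 2 + A / m)) =
          m * (((z.1 : ℝ) - p.1) ^ 2 + (z.2 - p.2) ^ 2) + A := by field_simp; ring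
      rw [this, hA, hp, hm]
      field_simp
      ring
    rw [e1, e2, ← one_div_mul_one_div, ← one_div_mul_one_div]
    ring
  rw [tsum_congr hterm, (sl.mul_left (1 / m)).tsum_add sg, tsum_mul_left]
  have hdec : ∀ X Y l : ℝ, 1 / m * X + Y - π / m * l = 1 / m * (X - π * l) + Y := by
    intro X Y l; ring
  rw [hdec]
  refine (abs_add_le _ _).trans ((add_le_add (b := 24 * (162 + 4 * M)) ?_ tg).trans ?_)
  · rw [abs_mul, abs_of_pos (by positivity : 0 < 1 / m)]
    have : 1 / m ≤ 1 := by rw [div_le_one (by positivity)]; exact hm1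
    refine (mul_le_of_le_one_left (abs_nonneg _) this).trans (tl.trans ?_)
    linarith
  · have : 0 < M * (1 / (μ + τ)) := by positivity
    nlinarith

theorem stmt_4 (M : ℝ) (hM : 1 < M) :
    ∃ c₀ C : ℝ, 0 < c₀ ∧ 0 < C ∧
      ∀ (L μ E_B τ : ℝ) (q : ℝ × ℝ), 0 < L → 0 < μ → E_B < 0 → -μ < τ →
        1 ≤ L ^ 2 * |E_B| → c₀ ≤ μ / |E_B| →
        |Gfun M L E_B μ q τ
            - (1 / (4 * π * (1 + 1 / M))) *
              Real.log ((nsq q / (M + 1) + (1 + 1 / M) * μ + τ) / |E_B|)| ≤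
          C * (1 + μ / ((μ + τ) * Real.log (μ / |E_B|))) ^ 3 := by
  have hM0 : 0 < M := by linarith
  refine ⟨40, 240000 * M, by norm_num, by positivity, ?_⟩
  intro L μ E_B τ q hL hμ hEB hτ hLE hμE
  have hE : 0 < |E_B| := abs_pos.2 hEB.ne
  set E : ℝ := |E_B| with hEdef
  have hπ := Real.pi_pos
  have hπ2 : 4 * π ^ 2 ≤ 40 := by nlinarith [Real.pi_lt_d2, Real.pi_pos]
  set h : ℝ := 2 * π / L with hh
  have hh0 : 0 < h := by positivity
  have hhsq : h ^ 2 = 4 * π ^ 2 / L ^ 2 := by rw [hh]; ring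
  have hhE : h ^ 2 ≤ 40 * E := by
    rw [hhsq, div_le_iff₀ (by positivity)]; nlinarith
  have hε : 0 < μ + τ := by linarith
  have hμ40 : 40 * E ≤ μ := (le_div_iff₀ hE).1 hμE
  have core := tsum_unit_lattice (E := E / h ^ 2) (μ := μ / h ^ 2) (τ := τ / h ^ 2) hM
    (by rw [le_div_iff₀ (by positivity)]; linarith)
    (by rw [le_div_iff₀ (by positivity)]; linarith)
    (by rw [← add_div]; positivity) (q.1 / h, q.2 / h)
  have hG : Gfun M L E_B μ q τ = 1 / (4 * π ^ 2) *
      ∑' z : ℤ × ℤ, (1 / ((1 + 1 / M) * ((z.1 : ℝ) ^ 2 + (z.2 : ℝ) ^ 2) + E / h ^ 2) -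
      chi (μ / h ^ 2) ((z.1 : ℝ) ^ 2 + (z.2 : ℝ) ^ 2) /
      ((1 / M) * ((q.1 / h - z.1) ^ 2 + (q.2 / h - z.2) ^ 2) + ((z.1 : ℝ) ^ 2 + (z.2 : ℝ) ^ 2)
        + τ / h ^ 2)) := by
    have hpre : 1 / (4 * π ^ 2) = 1 / L ^ 2 * (1 / h ^ 2) := by rw [hhsq]; field_simp
    rw [Gfun, hpre, mul_assoc]
    congr 1
    rw [← tsum_mul_left (a := 1 / h ^ 2)]
    refine tsum_congr fun z => ?_
    have e1 : nsq (kvec L z) = h ^ 2 * ((z.1 : ℝ) ^ 2 + (z.2 : ℝ) ^ 2) := by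
      simp only [nsq, kvec, ← hh]; ring
    have e2 : nsq (q - kvec L z) = h ^ 2 * ((q.1 / h - z.1) ^ 2 + (q.2 / h - z.2) ^ 2) := by
      simp only [nsq, kvec, ← hh, Prod.fst_sub, Prod.snd_sub]
      field_simp
    rw [e1, e2, ← hEdef]
    have e3 : chi μ (h ^ 2 * ((z.1 : ℝ) ^ 2 + (z.2 : ℝ) ^ 2)) =
        chi (μ / h ^ 2) ((z.1 : ℝ) ^ 2 + (z.2 : ℝ) ^ 2) := by
      simp only [chi, div_lt_iff₀ (show 0 < h ^ 2 by positivity), mul_comm (h ^ 2)]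
    rw [e3]
    set n : ℝ := (z.1 : ℝ) ^ 2 + (z.2 : ℝ) ^ 2
    set d : ℝ := (q.1 / h - z.1) ^ 2 + (q.2 / h - z.2) ^ 2
    have f1 : (1 + 1 / M) * (h ^ 2 * n) + E = h ^ 2 * ((1 + 1 / M) * n + E / h ^ 2) := by
      field_simp
    have f2 : 1 / M * (h ^ 2 * d) + h ^ 2 * n + τ = h ^ 2 * (1 / M * d + n + τ / h ^ 2) := by
      field_simp
    rw [f1, f2]
    simp only [div_eq_mul_inv, mul_inv]
    ring
  have hlog : ((((q.1 / h) ^ 2 + (q.2 / h) ^ 2) / (M + 1) + (1 + 1 / M) * (μ / h ^ 2) + τ / h ^ 2)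
      / (E / h ^ 2)) = (nsq q / (M + 1) + (1 + 1 / M) * μ + τ) / E := by
    rw [nsq]; field_simp
  dsimp only at core
  rw [hlog] at core
  rw [hG]
  set X : ℝ := μ / ((μ + τ) * Real.log (μ / E)) with hX
  have hlogpos : 0 < Real.log (μ / E) := Real.log_pos (by linarith)
  have hX0 : 0 < X := by positivity
  have hXE : E / (μ + τ) ≤ X := by
    rw [hX, div_le_div_iff₀ hε (by positivity)]
    have h1 : E * Real.log (μ / E) ≤ μ := by
      have h2 := Real.log_le_sub_one_of_pos (show 0 < μ / E by positivity)
      calc E * Real.log (μ / E) ≤ E * (μ / E) := by gcongr; linarith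
        _ = μ := by field_simp
    nlinarith
  have hεX : 1 / (μ / h ^ 2 + τ / h ^ 2) ≤ 40 * X := by
    rw [← add_div, one_div_div]
    calc h ^ 2 / (μ + τ) ≤ 40 * E / (μ + τ) := by gcongr
      _ = 40 * (E / (μ + τ)) := by ring
      _ ≤ 40 * X := by gcongr
  have hdec : ∀ Y l : ℝ, 1 / (4 * π ^ 2) * Y - 1 / (4 * π * (1 + 1 / M)) * l =
      1 / (4 * π ^ 2) * (Y - π / (1 + 1 / M) * l) := by
    intro Y l; field_simp
  rw [hdec, abs_mul, abs_of_pos (by positivity : 0 < 1 / (4 * π ^ 2))]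
  have hπ1 : 1 / (4 * π ^ 2) ≤ 1 := by
    rw [div_le_one (by positivity)]; nlinarith [Real.pi_gt_three]
  calc _ ≤ 6000 * M * (1 + 1 / (μ / h ^ 2 + τ / h ^ 2)) :=
        (mul_le_of_le_one_left (abs_nonneg _) hπ1).trans core
    _ ≤ 6000 * M * (1 + 40 * X) := by gcongr
    _ ≤ 240000 * M * (1 + X) := by nlinarith [mul_pos hM0 hX0]
    _ ≤ 240000 * M * (1 + X) ^ 3 := by
        gcongr
        exact le_self_pow₀ (by linarith) (by norm_num)
end

section
/- For every M > 1 there exists a constant c₀ > 0 such that for all L > 0, μ > 0 and E_B < 0 with L²|E_B| ≥ 1 and μ/|E_B| ≥ c₀, every e < 0 solving the polaron equation satisfies |e| ≤ μ. -/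
open Real MeasureTheory Set

/-- The sum over `ℤ` of the Lorentzian `1 / ((a x)² + b²)` is at most `8 / (a b)` for `a ≤ b`. -/
lemma summable_and_tsum_lorentzian_le {a b : ℝ} (ha : 0 < a) (hab : a ≤ b) :
    Summable (fun x : ℤ => 1 / ((a * x) ^ 2 + b ^ 2)) ∧
      ∑' x : ℤ, 1 / ((a * x) ^ 2 + b ^ 2) ≤ 8 / (a * b) := by
  have hb : 0 < b := ha.trans_le hab
  set f : ℤ → ℝ := fun x => 1 / ((a * x) ^ 2 + b ^ 2) with hf
  have hf0 : ∀ x, 0 ≤ f x := fun x => by positivity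
  have key : ∀ N : ℕ, f N ≤ 4 / (a * (a * N + b)) - 4 / (a * (a * ↑(N + 1) + b)) := by
    intro N
    have hu : (0 : ℝ) ≤ a * N := by positivity
    have h1 : 4 / (a * (a * N + b)) - 4 / (a * (a * ↑(N + 1) + b))
        = 4 / ((a * N + b) * (a * N + a + b)) := by
      push_cast
      have : a * N + b ≠ 0 := by positivity
      have : a * (N + 1) + b ≠ 0 := by positivity
      have : a * N + a + b ≠ 0 := by positivity
      field_simp
      ring
    rw [h1, hf]
    simp only [Int.cast_natCast]
    rw [div_le_div_iff₀ (by positivity) (by positivity)]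
    nlinarith [sq_nonneg (2 * (a * N) - b), mul_nonneg hu (sub_nonneg.2 hab),
      mul_nonneg hb.le (sub_nonneg.2 hab)]
  have partialSum : ∀ N : ℕ, ∑ n ∈ Finset.range N, f n
      ≤ 4 / (a * b) - 4 / (a * (a * N + b)) := by
    intro N
    induction N with
    | zero => simp
    | succ N ih => rw [Finset.sum_range_succ]; linarith [key N]
  have bound : ∀ N : ℕ, ∑ n ∈ Finset.range N, f n ≤ 4 / (a * b) := fun N => by
    have : 0 ≤ 4 / (a * (a * N + b)) := by positivity
    linarith [partialSum N]
  have hs1 : Summable (fun n : ℕ => f n) := summable_of_sum_range_le (fun n => hf0 n) bound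
  have ht1 : ∑' n : ℕ, f n ≤ 4 / (a * b) := Real.tsum_le_of_sum_range_le (fun n => hf0 n) bound
  have hle : ∀ n : ℕ, f (-(n + 1 : ℤ)) ≤ f n := by
    intro n
    simp only [hf]
    push_cast
    have : (0 : ℝ) ≤ n := by positivity
    apply one_div_le_one_div_of_le (by positivity)
    nlinarith [mul_nonneg (mul_pos ha ha).le this, mul_pos ha ha]
  have hs2 : Summable (fun n : ℕ => f (-(n + 1 : ℤ))) :=
    Summable.of_nonneg_of_le (fun n => hf0 _) hle hs1
  refine ⟨Summable.of_nat_of_neg_add_one hs1 hs2, ?_⟩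
  rw [tsum_of_nat_of_neg_add_one hs1 hs2]
  have h8 : 8 / (a * b) = 4 / (a * b) + 4 / (a * b) := by ring
  rw [h8]
  exact add_le_add ht1 ((hs2.tsum_le_tsum hle hs1).trans ht1)

lemma summable_and_tsum_prod_lorentzian_le {a b : ℝ} (ha : 0 < a) (hab : a ≤ b) :
    Summable (fun z : ℤ × ℤ => 1 / (((a * z.1) ^ 2 + b ^ 2) * ((a * z.2) ^ 2 + b ^ 2))) ∧
      ∑' z : ℤ × ℤ, 1 / (((a * z.1) ^ 2 + b ^ 2) * ((a * z.2) ^ 2 + b ^ 2))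
        ≤ 64 / (a ^ 2 * b ^ 2) := by
  have hb : 0 < b := ha.trans_le hab
  obtain ⟨hs, ht⟩ := summable_and_tsum_lorentzian_le ha hab
  have hnn : ∀ x : ℤ, 0 ≤ 1 / ((a * (x : ℝ)) ^ 2 + b ^ 2) := fun x => by positivity
  have hm := hs.mul_of_nonneg hs hnn hnn
  have heq : (fun z : ℤ × ℤ => 1 / (((a * z.1) ^ 2 + b ^ 2) * ((a * z.2) ^ 2 + b ^ 2)))
      = fun z : ℤ × ℤ => 1 / ((a * (z.1 : ℝ)) ^ 2 + b ^ 2) * (1 / ((a * (z.2 : ℝ)) ^ 2 + b ^ 2)) := by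
    funext z; rw [one_div_mul_one_div]
  rw [heq]
  refine ⟨hm, ?_⟩
  rw [← hs.tsum_mul_tsum hs hm]
  calc _ ≤ 8 / (a * b) * (8 / (a * b)) :=
        mul_le_mul ht ht (tsum_nonneg hnn) (by positivity)
    _ = _ := by field_simp; norm_num

/-- Pairing `k` with `-k` cancels the first-order term of the regularised summand of `G`. -/
lemma neg_le_regularised_pair {M E μ q₁ q₂ k₁ k₂ τ : ℝ} (hM : 1 < M) (hE : 0 < E) (hμ : 0 < μ)
    (hq : q₁ ^ 2 + q₂ ^ 2 ≤ μ) (hk : μ < k₁ ^ 2 + k₂ ^ 2) (hτ : μ - (q₁ ^ 2 + q₂ ^ 2) ≤ τ)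
    (hEμ : M * E ≤ μ) :
    0 ≤ 1 / ((1 + 1 / M) * (k₁ ^ 2 + k₂ ^ 2) + E)
        - 1 / ((1 / M) * ((q₁ - k₁) ^ 2 + (q₂ - k₂) ^ 2) + (k₁ ^ 2 + k₂ ^ 2) + τ)
      + (1 / ((1 + 1 / M) * (k₁ ^ 2 + k₂ ^ 2) + E)
        - 1 / ((1 / M) * ((q₁ + k₁) ^ 2 + (q₂ + k₂) ^ 2) + (k₁ ^ 2 + k₂ ^ 2) + τ))
      + 32 * μ * (1 / ((k₁ ^ 2 + μ) * (k₂ ^ 2 + μ))) := by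
  set s := k₁ ^ 2 + k₂ ^ 2 with hs
  set Q := q₁ ^ 2 + q₂ ^ 2 with hQ
  set w := 1 / M with hw
  have hM0 : 0 < M := by linarith
  have hw0 : 0 < w := by positivity
  have hw1 : w ≤ 1 := by rw [hw, div_le_one hM0]; exact hM.le
  have hwE : E ≤ w * μ := by rw [hw, one_div, inv_mul_eq_div, le_div_iff₀ hM0]; linarith
  have hs0 : 0 < s := hμ.trans hk
  have hQ0 : 0 ≤ Q := by positivity
  have hτ0 : 0 ≤ τ := by linarith
  set A := (1 + w) * s + E with hA
  set B := (1 + w) * s + w * Q + τ with hB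
  set t := 2 * w * (q₁ * k₁ + q₂ * k₂) with ht
  have hD1 : w * ((q₁ - k₁) ^ 2 + (q₂ - k₂) ^ 2) + s + τ = B - t := by
    rw [hB, ht, hs, hQ]; ring
  have hD2 : w * ((q₁ + k₁) ^ 2 + (q₂ + k₂) ^ 2) + s + τ = B + t := by
    rw [hB, ht, hs, hQ]; ring
  have hs1 : s ≤ B - t := by
    have : 0 ≤ w * ((q₁ - k₁) ^ 2 + (q₂ - k₂) ^ 2) := by positivity
    linarith
  have hs2 : s ≤ B + t := by
    have : 0 ≤ w * ((q₁ + k₁) ^ 2 + (q₂ + k₂) ^ 2) := by positivity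
    linarith
  rw [hD1, hD2]
  have hAB : A ≤ B := by
    have : 0 ≤ (1 - w) * (μ - Q) := mul_nonneg (by linarith) (by linarith)
    rw [hA, hB]; nlinarith
  have hA0 : 0 < A := by positivity
  have hB0 : 0 < B := hA0.trans_le hAB
  have hsB : s ≤ B := by linarith
  have hp1 : 0 < B - t := by linarith
  have hp2 : 0 < B + t := by linarith
  have ht2 : t ^ 2 ≤ 4 * μ * s := by
    have hcs : (q₁ * k₁ + q₂ * k₂) ^ 2 ≤ Q * s := by
      rw [hQ, hs]; nlinarith [sq_nonneg (q₁ * k₂ - q₂ * k₁)]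
    have h1 : Q * s ≤ μ * s := mul_le_mul_of_nonneg_right hq hs0.le
    have h2 : t ^ 2 = 4 * w ^ 2 * (q₁ * k₁ + q₂ * k₂) ^ 2 := by rw [ht]; ring
    have h3 : w ^ 2 ≤ 1 := pow_le_one₀ hw0.le hw1
    rw [h2]
    nlinarith [mul_le_mul h3 (hcs.trans h1) (sq_nonneg _) zero_le_one]
  clear_value A B t
  clear hD1 hD2 hA hB ht
  have e1 : 1 / (B - t) + 1 / (B + t) = 2 / B + 2 * t ^ 2 / (B * ((B - t) * (B + t))) := by
    field_simp; ring
  have e2 : 2 * t ^ 2 / (B * ((B - t) * (B + t))) ≤ 8 * μ / s ^ 2 := by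
    calc 2 * t ^ 2 / (B * ((B - t) * (B + t))) ≤ 2 * (4 * μ * s) / (s * (s * s)) := by
          gcongr
      _ = 8 * μ / s ^ 2 := by field_simp; norm_num
  have e3 : 8 * μ / s ^ 2 ≤ 32 * μ * (1 / ((k₁ ^ 2 + μ) * (k₂ ^ 2 + μ))) := by
    have : (k₁ ^ 2 + μ) * (k₂ ^ 2 + μ) ≤ (2 * s) * (2 * s) := by
      apply mul_le_mul _ _ (by positivity) (by positivity) <;>
        nlinarith [sq_nonneg k₁, sq_nonneg k₂]
    calc 8 * μ / s ^ 2 = 32 * μ * (1 / ((2 * s) * (2 * s))) := by field_simp; norm_num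
      _ ≤ _ := by gcongr
  have e4 : 2 / B ≤ 2 / A := div_le_div_of_nonneg_left (by norm_num) hA0 hAB
  have e5 : 2 / A = 1 / A + 1 / A := by ring
  linarith

lemma log_sub_log_le_sum_one_div {m n : ℕ} (hm : 0 < m) (hmn : m ≤ n) :
    Real.log n - Real.log m ≤ ∑ j ∈ Finset.Ico m n, 1 / (j : ℝ) := by
  induction n, hmn using Nat.le_induction with
  | base => simp
  | succ n hn ih =>
    rw [Finset.sum_Ico_succ_top hn]
    have hn0 : (0 : ℝ) < n := by exact_mod_cast hm.trans_le hn
    have h := Real.log_le_sub_one_of_pos (x := ((n + 1 : ℕ) : ℝ) / n) (by positivity)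
    rw [Real.log_div (by positivity) hn0.ne'] at h
    have : ((n + 1 : ℕ) : ℝ) / n - 1 = 1 / n := by push_cast; field_simp; ring
    linarith

/-- The triangle `{(j, i) : m ≤ j < n, 0 ≤ i < j}` in `ℤ²`. -/
def latticeTriangle (m n : ℕ) : Finset (ℤ × ℤ) :=
  ((Finset.Ico m n).sigma fun j => Finset.range j).image fun p => ((p.1 : ℤ), (p.2 : ℤ))

lemma sum_latticeTriangle (m n : ℕ) (F : ℤ × ℤ → ℝ) :
    ∑ z ∈ latticeTriangle m n, F z
      = ∑ j ∈ Finset.Ico m n, ∑ i ∈ Finset.range j, F ((j : ℤ), (i : ℤ)) := by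
  rw [latticeTriangle, Finset.sum_image, Finset.sum_sigma]
  rintro ⟨a, b⟩ - ⟨c, d⟩ - h
  simp only [Prod.mk.injEq, Nat.cast_inj] at h
  obtain ⟨rfl, rfl⟩ := h
  rfl

lemma mem_box_of_nsq_le {a μ : ℝ} (ha : 0 < a) {z : ℤ × ℤ}
    (hz : (a * z.1) ^ 2 + (a * z.2) ^ 2 ≤ μ) :
    z ∈ Finset.Icc (-(⌊√μ / a⌋₊ : ℤ)) ⌊√μ / a⌋₊ ×ˢ Finset.Icc (-(⌊√μ / a⌋₊ : ℤ)) ⌊√μ / a⌋₊ := by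
  have aux : ∀ x : ℤ, (a * x) ^ 2 ≤ μ → x ∈ Finset.Icc (-(⌊√μ / a⌋₊ : ℤ)) ⌊√μ / a⌋₊ := by
    intro x hx
    have h1 : a * |(x : ℝ)| ≤ √μ := by
      have := Real.abs_le_sqrt hx
      rwa [abs_mul, abs_of_pos ha] at this
    have h2 : ((x.natAbs : ℕ) : ℝ) ≤ √μ / a := by
      rw [le_div_iff₀ ha, Nat.cast_natAbs, Int.cast_abs]; linarith
    have h3 := Nat.le_floor h2
    rw [Finset.mem_Icc]
    omega
  rw [Finset.mem_product]
  exact ⟨aux _ (by nlinarith [sq_nonneg (a * (z.2 : ℝ))]),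
    aux _ (by nlinarith [sq_nonneg (a * (z.1 : ℝ))])⟩

lemma summable_inv_norm_cube : Summable fun z : ℤ × ℤ => 1 / ‖z‖ ^ 3 := by
  have h := EisensteinSeries.summable_one_div_norm_rpow (k := 3) (by norm_num)
  rw [← (finTwoArrowEquiv ℤ).symm.summable_iff] at h
  refine h.congr fun z => ?_
  have : ‖(finTwoArrowEquiv ℤ).symm z‖ = ‖z‖ := by
    simp [EisensteinSeries.norm_eq_max_natAbs, Prod.norm_def, Int.norm_eq_abs, Nat.cast_natAbs]
  simp only [Function.comp, this]
  rw [Real.rpow_neg (norm_nonneg _), one_div]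
  norm_cast

/-- The summand of `G`, written in terms of the lattice spacing `a`. -/
noncomputable def gTerm (M a E μ q₁ q₂ τ : ℝ) (z : ℤ × ℤ) : ℝ :=
  1 / ((1 + 1 / M) * ((a * z.1) ^ 2 + (a * z.2) ^ 2) + E)
    - chi μ ((a * z.1) ^ 2 + (a * z.2) ^ 2)
      / ((1 / M) * ((q₁ - a * z.1) ^ 2 + (q₂ - a * z.2) ^ 2)
        + ((a * z.1) ^ 2 + (a * z.2) ^ 2) + τ)

lemma summable_gTerm {M a E μ q₁ q₂ τ : ℝ} (hM : 0 < M) (ha : 0 < a) (hE : 0 < E) (hμ : 0 < μ)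
    (hτ : 0 ≤ τ) : Summable (gTerm M a E μ q₁ q₂ τ) := by
  set C : ℝ := (1 / M) * 2 * (|q₁| + |q₂|) * a + |(1 / M) * (q₁ ^ 2 + q₂ ^ 2) + τ - E| with hC
  refine Summable.of_norm_bounded_eventually (summable_inv_norm_cube.mul_left (C / a ^ 4)) ?_
  have hfin : Set.Finite {z : ℤ × ℤ | (a * z.1) ^ 2 + (a * z.2) ^ 2 ≤ μ} :=
    (Finset.finite_toSet _).subset fun z hz => mem_box_of_nsq_le ha hz
  filter_upwards [hfin.compl_mem_cofinite] with z hz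
  have hz' : μ < (a * z.1) ^ 2 + (a * z.2) ^ 2 := by simpa using hz
  set k₁ : ℝ := a * z.1 with hk₁
  set k₂ : ℝ := a * z.2 with hk₂
  set N := ‖z‖ with hN
  have hN1 : |(z.1 : ℝ)| ≤ N := by rw [hN, ← Int.norm_eq_abs]; exact norm_fst_le z
  have hN2 : |(z.2 : ℝ)| ≤ N := by rw [hN, ← Int.norm_eq_abs]; exact norm_snd_le z
  have hz0 : z ≠ 0 := by
    rintro rfl
    simp [hk₁, hk₂] at hz'
    linarith
  have hNcases : N = |(z.1 : ℝ)| ∨ N = |(z.2 : ℝ)| := by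
    rw [hN, Prod.norm_def, Int.norm_eq_abs, Int.norm_eq_abs]
    exact max_choice _ _
  have hN0 : 1 ≤ N := by
    have hpos : 0 < N := norm_pos_iff.2 hz0
    rcases hNcases with h | h <;> rw [h] at hpos ⊢ <;>
      exact_mod_cast Int.one_le_abs (by simpa using hpos)
  have hNs : a ^ 2 * N ^ 2 ≤ k₁ ^ 2 + k₂ ^ 2 := by
    rw [hk₁, hk₂]
    rcases hNcases with h | h <;> rw [h, sq_abs]
    · nlinarith [sq_nonneg (a * (z.2 : ℝ))]
    · nlinarith [sq_nonneg (a * (z.1 : ℝ))]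
  have hk1 : |k₁| ≤ a * N := by rw [hk₁, abs_mul, abs_of_pos ha]; gcongr
  have hk2 : |k₂| ≤ a * N := by rw [hk₂, abs_mul, abs_of_pos ha]; gcongr
  have hgt : gTerm M a E μ q₁ q₂ τ z = 1 / ((1 + 1 / M) * (k₁ ^ 2 + k₂ ^ 2) + E)
      - 1 / ((1 / M) * ((q₁ - k₁) ^ 2 + (q₂ - k₂) ^ 2) + (k₁ ^ 2 + k₂ ^ 2) + τ) := by
    rw [gTerm, ← hk₁, ← hk₂, chi, if_pos hz']
  rw [hgt, Real.norm_eq_abs]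
  set s := k₁ ^ 2 + k₂ ^ 2 with hs
  set w := 1 / M with hw
  have hw0 : 0 < w := by positivity
  have hs0 : 0 < s := hμ.trans hz'
  have hAs : s ≤ (1 + w) * s + E := by nlinarith
  have hDs : s ≤ w * ((q₁ - k₁) ^ 2 + (q₂ - k₂) ^ 2) + s + τ := by
    have : 0 ≤ w * ((q₁ - k₁) ^ 2 + (q₂ - k₂) ^ 2) := by positivity
    linarith
  have hnum : |w * ((q₁ - k₁) ^ 2 + (q₂ - k₂) ^ 2) + s + τ - ((1 + w) * s + E)| ≤ C * N := by
    have e : w * ((q₁ - k₁) ^ 2 + (q₂ - k₂) ^ 2) + s + τ - ((1 + w) * s + E)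
        = (w * (q₁ ^ 2 + q₂ ^ 2) + τ - E) - w * 2 * (q₁ * k₁ + q₂ * k₂) := by rw [hs]; ring
    rw [e]
    have h1 : |w * 2 * (q₁ * k₁ + q₂ * k₂)| ≤ w * 2 * (|q₁| * (a * N) + |q₂| * (a * N)) := by
      rw [abs_mul, abs_of_pos (by positivity : 0 < w * 2)]
      gcongr
      refine (abs_add_le _ _).trans ?_
      rw [abs_mul q₁ k₁, abs_mul q₂ k₂]
      gcongr
    have h2 : |w * (q₁ ^ 2 + q₂ ^ 2) + τ - E| ≤ |w * (q₁ ^ 2 + q₂ ^ 2) + τ - E| * N :=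
      le_mul_of_one_le_right (abs_nonneg _) hN0
    refine (abs_sub _ _).trans ?_
    rw [hC]
    linarith
  set A := (1 + w) * s + E
  set D := w * ((q₁ - k₁) ^ 2 + (q₂ - k₂) ^ 2) + s + τ
  have hA0 : 0 < A := by linarith
  have hD0 : 0 < D := by linarith
  have hN0' : 0 < N := by linarith
  have hden : (a ^ 2 * N ^ 2) * (a ^ 2 * N ^ 2) ≤ A * D :=
    mul_le_mul (by linarith) (by linarith) (by positivity) hA0.le
  rw [div_sub_div _ _ hA0.ne' hD0.ne', one_mul, mul_one, abs_div, abs_of_pos (mul_pos hA0 hD0)]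
  calc |D - A| / (A * D) ≤ C * N / ((a ^ 2 * N ^ 2) * (a ^ 2 * N ^ 2)) := by
        gcongr
    _ = C / a ^ 4 * (1 / N ^ 3) := by field_simp

lemma tsum_gTerm_ge {M a E μ q₁ q₂ τ : ℝ} (hM : 1 < M) (ha : 0 < a) (hE : 0 < E) (haμ : a ^ 2 ≤ μ)
    (hq : q₁ ^ 2 + q₂ ^ 2 ≤ μ) (hτ : μ - (q₁ ^ 2 + q₂ ^ 2) ≤ τ) (hEμ : M * E ≤ μ)
    (T : Finset (ℤ × ℤ)) (hT : ∀ z ∈ T, (a * z.1) ^ 2 + (a * z.2) ^ 2 ≤ μ) :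
    ∑ z ∈ T, 1 / ((1 + 1 / M) * ((a * z.1) ^ 2 + (a * z.2) ^ 2) + E) - 1024 / a ^ 2
      ≤ ∑' z, gTerm M a E μ q₁ q₂ τ z := by
  have hM0 : 0 < M := by linarith
  have hμ : 0 < μ := lt_of_lt_of_le (by positivity) haμ
  have hsqrt : √μ ^ 2 = μ := Real.sq_sqrt hμ.le
  obtain ⟨hr, hrt⟩ := summable_and_tsum_prod_lorentzian_le ha (Real.le_sqrt_of_sq_le haμ)
  rw [hsqrt] at hr hrt
  set r : ℤ × ℤ → ℝ := fun z => 1 / (((a * z.1) ^ 2 + μ) * ((a * z.2) ^ 2 + μ)) with hrdef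
  set g := gTerm M a E μ q₁ q₂ τ with hg
  have hgs : Summable g := summable_gTerm hM0 ha hE hμ (by linarith)
  have hgs' : Summable (fun z => g (-z)) := (Equiv.neg (ℤ × ℤ)).summable_iff.2 hgs
  have hgt' : ∑' z, g (-z) = ∑' z, g z := (Equiv.neg (ℤ × ℤ)).tsum_eq g
  set F : ℤ × ℤ → ℝ := fun z => (g z + g (-z)) + 32 * μ * r z with hF
  have hFs : Summable F := (hgs.add hgs').add (hr.mul_left _)
  have hFt : ∑' z, F z = 2 * ∑' z, g z + 32 * μ * ∑' z, r z := by
    rw [hF, (hgs.add hgs').tsum_add (hr.mul_left _), hgs.tsum_add hgs', tsum_mul_left, hgt']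
    ring
  have hin : ∀ z : ℤ × ℤ, (a * z.1) ^ 2 + (a * z.2) ^ 2 ≤ μ →
      2 * (1 / ((1 + 1 / M) * ((a * z.1) ^ 2 + (a * z.2) ^ 2) + E)) ≤ F z := by
    intro z hz
    have hr0 : 0 ≤ 32 * μ * r z := by positivity
    simp only [hF, hg, gTerm, Prod.fst_neg, Prod.snd_neg, Int.cast_neg, mul_neg, neg_sq, chi,
      if_neg hz.not_gt, zero_div, sub_zero]
    linarith
  have hF0 : ∀ z, 0 ≤ F z := by
    intro z
    by_cases hz : (a * z.1) ^ 2 + (a * z.2) ^ 2 ≤ μ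
    · exact le_trans (by positivity) (hin z hz)
    · have := neg_le_regularised_pair hM hE hμ hq (not_le.1 hz) hτ hEμ
      simp only [hF, hg, gTerm, Prod.fst_neg, Prod.snd_neg, Int.cast_neg, mul_neg, neg_sq, chi,
        if_pos (not_le.1 hz), sub_neg_eq_add]
      exact this
  have h1 : ∑ z ∈ T, 2 * (1 / ((1 + 1 / M) * ((a * z.1) ^ 2 + (a * z.2) ^ 2) + E)) ≤ ∑' z, F z :=
    (Finset.sum_le_sum fun z hz => hin z (hT z hz)).trans
      (hFs.sum_le_tsum T fun z _ => hF0 z)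
  rw [← Finset.mul_sum, hFt] at h1
  have h2 : 32 * μ * ∑' z, r z ≤ 2 * (1024 / a ^ 2) := by
    calc 32 * μ * ∑' z, r z ≤ 32 * μ * (64 / (a ^ 2 * μ)) := by gcongr
      _ = 2 * (1024 / a ^ 2) := by field_simp; norm_num
  linarith

lemma exists_finset_sum_ge {w a E μ : ℝ} (hw : 0 < w) (ha : 0 < a) (hE : 0 < E) (hμ : 0 < μ)
    (haE : a ^ 2 ≤ 40 * E) {X : ℝ} (hX : 0 ≤ X) (hc : 128 * Real.exp (2 * X) ≤ μ / E) :
    ∃ T : Finset (ℤ × ℤ), (∀ z ∈ T, (a * z.1) ^ 2 + (a * z.2) ^ 2 ≤ μ) ∧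
      X / ((2 * w + 1) * a ^ 2) ≤ ∑ z ∈ T, 1 / (w * ((a * z.1) ^ 2 + (a * z.2) ^ 2) + E) := by
  set m := ⌈√E / a⌉₊ with hm
  set n := ⌈√(μ / 2) / a⌉₊ with hn
  have hsE : 0 < √E := Real.sqrt_pos.2 hE
  have hm0 : 0 < m := Nat.ceil_pos.2 (by positivity)
  have hm1 : √E / a ≤ m := Nat.le_ceil _
  have hm2 : (m : ℝ) ≤ 8 * √E / a := by
    have h1 := (Nat.ceil_lt_add_one (by positivity : 0 ≤ √E / a)).le
    have h2 : a ≤ 7 * √E := by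
      apply le_of_sq_le_sq _ (by positivity)
      rw [mul_pow, Real.sq_sqrt hE.le]; linarith
    have h3 : 1 ≤ 7 * √E / a := by rwa [le_div_iff₀ ha, one_mul]
    have h4 : 8 * √E / a = √E / a + 7 * √E / a := by ring
    rw [h4]; linarith
  have hn1 : √(μ / 2) / a ≤ n := Nat.le_ceil _
  have hmn : (m : ℝ) * Real.exp X ≤ n := by
    have h1 : 8 * √E * Real.exp X ≤ √(μ / 2) := by
      apply Real.le_sqrt_of_sq_le
      have : Real.exp X ^ 2 = Real.exp (2 * X) := by rw [← Real.exp_nat_mul]; norm_num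
      rw [mul_pow, mul_pow, Real.sq_sqrt hE.le, this]
      rw [le_div_iff₀ hE] at hc
      linarith
    calc (m : ℝ) * Real.exp X ≤ 8 * √E / a * Real.exp X := by gcongr
      _ = 8 * √E * Real.exp X / a := by ring
      _ ≤ √(μ / 2) / a := by gcongr
      _ ≤ n := hn1
  have hmR : (0 : ℝ) < m := by exact_mod_cast hm0
  have hle : m ≤ n := by
    have : (m : ℝ) ≤ n := (le_mul_of_one_le_right hmR.le (Real.one_le_exp hX)).trans hmn
    exact_mod_cast this
  have hlog : X ≤ ∑ j ∈ Finset.Ico m n, 1 / (j : ℝ) := by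
    refine le_trans ?_ (log_sub_log_le_sum_one_div hm0 hle)
    have := Real.log_le_log (by positivity) hmn
    rw [Real.log_mul hmR.ne' (Real.exp_ne_zero _), Real.log_exp] at this
    linarith
  refine ⟨latticeTriangle m n, ?_, ?_⟩
  · intro z hz
    simp only [latticeTriangle, Finset.mem_image, Finset.mem_sigma, Finset.mem_Ico,
      Finset.mem_range] at hz
    obtain ⟨⟨j, i⟩, ⟨⟨-, hj⟩, hi⟩, rfl⟩ := hz
    have hj' : (j : ℝ) < √(μ / 2) / a := Nat.lt_ceil.1 hj
    have hi' : (i : ℝ) ≤ j := by exact_mod_cast hi.le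
    rw [lt_div_iff₀ ha] at hj'
    have h1 : (a * j) ^ 2 ≤ μ / 2 := by
      rw [← Real.sq_sqrt (by positivity : 0 ≤ μ / 2)]
      exact pow_le_pow_left₀ (by positivity) (by linarith) 2
    have h2 : (a * i) ^ 2 ≤ (a * j) ^ 2 := by gcongr
    push_cast
    linarith
  · rw [sum_latticeTriangle]
    have hj : ∀ j ∈ Finset.Ico m n, 1 / ((2 * w + 1) * a ^ 2) * (1 / (j : ℝ)) ≤
        ∑ i ∈ Finset.range j,
          1 / (w * ((a * ((j : ℤ) : ℝ)) ^ 2 + (a * ((i : ℤ) : ℝ)) ^ 2) + E) := by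
      intro j hj
      have hmj : (m : ℝ) ≤ j := by exact_mod_cast (Finset.mem_Ico.1 hj).1
      have hj0 : (0 : ℝ) < j := hmR.trans_le hmj
      have hEj : E ≤ (a * j) ^ 2 := by
        have : √E ≤ a * j := by
          have := hm1.trans hmj
          rw [div_le_iff₀ ha] at this; linarith
        rw [← Real.sq_sqrt hE.le]
        gcongr
      have hterm : ∀ i ∈ Finset.range j, 1 / ((2 * w + 1) * (a * j) ^ 2) ≤
          1 / (w * ((a * ((j : ℤ) : ℝ)) ^ 2 + (a * ((i : ℤ) : ℝ)) ^ 2) + E) := by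
        intro i hi
        have hi' : (i : ℝ) ≤ j := by exact_mod_cast (Finset.mem_range.1 hi).le
        have h2 : (a * (i : ℝ)) ^ 2 ≤ (a * j) ^ 2 := by gcongr
        apply one_div_le_one_div_of_le (by positivity)
        push_cast
        nlinarith
      refine le_trans (le_of_eq ?_) (Finset.card_nsmul_le_sum _ _ _ hterm)
      rw [Finset.card_range, nsmul_eq_mul]
      field_simp
    refine le_trans ?_ (Finset.sum_le_sum hj)
    rw [← Finset.mul_sum, div_eq_mul_one_div, mul_comm]
    gcongr

theorem stmt_5 (M : ℝ) (hM : 1 < M) :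
    ∃ c₀ : ℝ, 0 < c₀ ∧
      ∀ L μ E_B e : ℝ, 0 < L → 0 < μ → E_B < 0 →
        1 ≤ L ^ 2 * |E_B| → c₀ ≤ μ / |E_B| →
        e < 0 → PolaronEq M L E_B μ e → |e| ≤ μ := by
  have hM0 : 0 < M := by linarith
  set w := 1 + 1 / M with hw
  have hw0 : 0 < w := by positivity
  set X : ℝ := 30 * (4 * π ^ 2 * (2 * w + 1)) with hX
  have hX0 : 0 < X := by positivity
  refine ⟨128 * Real.exp (2 * X) + M, by positivity, ?_⟩
  intro L μ E_B e hL hμ hEB hLE hc he hpol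
  by_contra! hcon
  rw [abs_of_neg he] at hcon
  set E := |E_B| with hEdef
  have hE : 0 < E := abs_pos.2 hEB.ne
  set a := 2 * π / L with ha_def
  have hπ3 : 3 < π := Real.pi_gt_three
  have hπ4 : π < 3.15 := Real.pi_lt_d2
  have ha : 0 < a := by positivity
  have hL2 : 1 / L ^ 2 = a ^ 2 / (4 * π ^ 2) := by rw [ha_def]; field_simp; norm_num
  have haE : a ^ 2 ≤ 40 * E := by
    have h1 : a ^ 2 * L ^ 2 = 4 * π ^ 2 := by rw [ha_def]; field_simp; norm_num
    have h2 : 4 * π ^ 2 ≤ 40 := by nlinarith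
    have hLpos : 0 < L ^ 2 := by positivity
    by_contra! h
    nlinarith [mul_lt_mul_of_pos_right h hLpos]
  have hexp : 1 ≤ Real.exp (2 * X) := Real.one_le_exp (by positivity)
  have hc' : (128 * Real.exp (2 * X) + M) * E ≤ μ := (le_div_iff₀ hE).1 hc
  have hEμ : M * E ≤ μ := by nlinarith
  have haμ : a ^ 2 ≤ μ := by nlinarith
  obtain ⟨T, hT, hTs⟩ := exists_finset_sum_ge hw0 ha hE hμ haE hX0.le (by linarith)
  have hG : ∀ z : ℤ × ℤ, nsq (kvec L z) ≤ μ →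
      1 ≤ Gfun M L E_B μ (kvec L z) (-(nsq (kvec L z)) - e) := by
    intro z hz
    have hq : (a * z.1) ^ 2 + (a * z.2) ^ 2 ≤ μ := hz
    have h := tsum_gTerm_ge (τ := -((a * z.1) ^ 2 + (a * z.2) ^ 2) - e) hM ha hE haμ hq
      (by linarith) hEμ T hT
    have hGeq : Gfun M L E_B μ (kvec L z) (-(nsq (kvec L z)) - e) = 1 / L ^ 2 *
        ∑' x, gTerm M a E μ (a * z.1) (a * z.2) (-((a * z.1) ^ 2 + (a * z.2) ^ 2) - e) x := rfl
    rw [hGeq, hL2]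
    have h1 : X / ((2 * w + 1) * a ^ 2) = 120 * π ^ 2 / a ^ 2 := by rw [hX]; field_simp; norm_num
    rw [h1] at hTs
    have h2 : (120 * π ^ 2 - 1024) / a ^ 2 ≤
        ∑' x, gTerm M a E μ (a * z.1) (a * z.2) (-((a * z.1) ^ 2 + (a * z.2) ^ 2) - e) x := by
      rw [sub_div]; linarith
    calc (1 : ℝ) ≤ a ^ 2 / (4 * π ^ 2) * ((120 * π ^ 2 - 1024) / a ^ 2) := by
          rw [div_mul_div_cancel₀' (by positivity) , le_div_iff₀ (by positivity)]
          nlinarith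
      _ ≤ _ := by gcongr
  set R := ⌊√μ / a⌋₊ with hR
  have hsum : (∑' z : ℤ × ℤ, if nsq (kvec L z) ≤ μ then
      1 / Gfun M L E_B μ (kvec L z) (-(nsq (kvec L z)) - e) else 0) ≤ (2 * R + 1) ^ 2 := by
    rw [tsum_eq_sum (s := Finset.Icc (-(R : ℤ)) R ×ˢ Finset.Icc (-(R : ℤ)) R)]
    · refine (Finset.sum_le_card_nsmul _ _ 1 ?_).trans (le_of_eq ?_)
      · intro z _
        split_ifs with hz
        · exact div_le_one_of_le₀ (hG z hz) (by linarith [hG z hz])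
        · exact zero_le_one
      · have : ((R : ℤ) + 1 - -(R : ℤ)).toNat = 2 * R + 1 := by omega
        rw [Finset.card_product, Int.card_Icc, this, nsmul_eq_mul]
        push_cast; ring
    · intro z hz
      exact if_neg fun h => hz (mem_box_of_nsq_le ha h)
  have hRle : (R : ℝ) ≤ √μ / a := Nat.floor_le (by positivity)
  have h1 : 1 ≤ √μ / a := by rw [le_div_iff₀ ha, one_mul]; exact Real.le_sqrt_of_sq_le haμ
  have h2 : (2 * (R : ℝ) + 1) ^ 2 ≤ 9 * μ / a ^ 2 := by
    calc (2 * (R : ℝ) + 1) ^ 2 ≤ (3 * (√μ / a)) ^ 2 := by gcongr; linarith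
      _ = 9 * μ / a ^ 2 := by rw [mul_pow, div_pow, Real.sq_sqrt hμ.le]; ring
  have h3 : -e ≤ μ := by
    rw [PolaronEq] at hpol
    have : -e = 1 / L ^ 2 * ∑' z : ℤ × ℤ, if nsq (kvec L z) ≤ μ then
      1 / Gfun M L E_B μ (kvec L z) (-(nsq (kvec L z)) - e) else 0 := by linarith
    rw [this, hL2]
    calc _ ≤ a ^ 2 / (4 * π ^ 2) * (9 * μ / a ^ 2) := by gcongr; exact hsum.trans h2
      _ = 9 * μ / (4 * π ^ 2) := by field_simp
      _ ≤ μ := by rw [div_le_iff₀ (by positivity)]; nlinarith [mul_pos hμ Real.pi_pos]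
  linarith
end
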